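/- arXiv:1507.07949 — 3 statements merged into one kernel-verified Lean document; each statement's English description precedes it below -/
import Mathlib

section
/- For every real $p \ge 2$, $\frac{1}{\pi}\int_{-\infty}^{\infty} \left|\frac{\sin t}{t}\right|^p dt \le \sqrt{2/p}$. -/
open MeasureTheory
open Set Filter Topology

lemma sin_quotient_sq_le (t : ℝ) : |Real.sin t / t| ^ 2 ≤ 2 * (1 + t ^ 2)⁻¹ := by
  rcases eq_or_ne t 0 with rfl | ht
  · simp
  · have ht2 : 0 < t ^ 2 := by positivity
    rw [sq_abs, div_pow, ← div_eq_mul_inv, div_le_div_iff₀ ht2 (by positivity)]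
    have h1 := Real.sin_sq_le_one t
    have h2 := Real.sin_sq_le_sq (x := t)
    nlinarith

lemma abs_sin_quotient_le_one (t : ℝ) : |Real.sin t / t| ≤ 1 := by
  rw [abs_div]
  exact div_le_one_of_le₀ Real.abs_sin_le_abs (abs_nonneg t)

lemma integrable_sin_quotient_rpow {p : ℝ} (hp : 2 ≤ p) :
    Integrable fun t : ℝ => |Real.sin t / t| ^ p := by
  refine (integrable_inv_one_add_sq.const_mul 2).mono' ?_ (ae_of_all _ fun t => ?_)
  · exact Measurable.aestronglyMeasurable (by fun_prop)
  · rw [Real.norm_of_nonneg (by positivity)]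
    refine le_trans ?_ (sin_quotient_sq_le t)
    rw [← Real.rpow_natCast]
    exact Real.rpow_le_rpow_of_exponent_ge_of_imp (abs_nonneg _) (abs_sin_quotient_le_one t)
      (by exact_mod_cast hp) (by intro _ h; linarith)

lemma integrable_sin_quotient_pow {n : ℕ} (hn : 2 ≤ n) :
    Integrable fun t : ℝ => |Real.sin t / t| ^ n := by
  simpa using integrable_sin_quotient_rpow (p := n) (by exact_mod_cast hn)

/-- The Dirichlet kernel, with its integral over a half period. -/
lemma exists_dirichlet_kernel (n : ℕ) : ∃ D : ℝ → ℝ, Continuous D ∧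
    (∫ x in (0 : ℝ)..(Real.pi / 2), D x) = Real.pi / 2 ∧
    ∀ x, D x * Real.sin x = Real.sin ((2 * n + 1) * x) := by
  induction n with
  | zero => exact ⟨fun _ => 1, continuous_const, by simp, by simp⟩
  | succ n ih =>
    obtain ⟨D, hD, hI, hs⟩ := ih
    refine ⟨fun x => D x + 2 * Real.cos (2 * (n + 1) * x), by fun_prop, ?_, fun x => ?_⟩
    · have hn : (2 * ((n : ℝ) + 1)) ≠ 0 := by positivity
      rw [intervalIntegral.integral_add (hD.intervalIntegrable _ _)
        (Continuous.intervalIntegrable (by fun_prop) _ _), hI,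
        intervalIntegral.integral_const_mul,
        intervalIntegral.integral_comp_mul_left (fun x => Real.cos x) hn, integral_cos]
      have : 2 * ((n : ℝ) + 1) * (Real.pi / 2) = ((n + 1 : ℕ) : ℝ) * Real.pi := by
        push_cast; ring
      rw [this, Real.sin_nat_mul_pi]
      simp
    · have h := Real.sin_sub_sin ((2 * ((n : ℝ) + 1) + 1) * x) ((2 * n + 1) * x)
      have e1 : ((2 * ((n : ℝ) + 1) + 1) * x - (2 * n + 1) * x) / 2 = x := by ring
      have e2 : ((2 * ((n : ℝ) + 1) + 1) * x + (2 * n + 1) * x) / 2 = 2 * (n + 1) * x := by ring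
      rw [e1, e2] at h
      push_cast
      linear_combination hs x - h

/-- The Fejér kernel, with its integral over a half period. -/
lemma exists_fejer_kernel (n : ℕ) : ∃ F : ℝ → ℝ, Continuous F ∧
    (∫ x in (0 : ℝ)..(Real.pi / 2), F x) = n * (Real.pi / 2) ∧
    ∀ x, F x * Real.sin x ^ 2 = Real.sin (n * x) ^ 2 := by
  induction n with
  | zero => exact ⟨fun _ => 0, continuous_const, by simp, by simp⟩
  | succ n ih =>
    obtain ⟨F, hF, hI, hs⟩ := ih
    obtain ⟨D, hD, hDI, hDs⟩ := exists_dirichlet_kernel n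
    refine ⟨fun x => F x + D x, by fun_prop, ?_, fun x => ?_⟩
    · rw [intervalIntegral.integral_add (hF.intervalIntegrable _ _)
        (hD.intervalIntegrable _ _), hI, hDI]
      push_cast; ring
    · have e1 : (2 * (n : ℝ) + 1) * x = n * x + (n * x + x) := by ring
      have e2 : ((n + 1 : ℕ) : ℝ) * x = n * x + x := by push_cast; ring
      have h2 : D x * Real.sin x ^ 2 = Real.sin (n * x + (n * x + x)) * Real.sin x := by
        rw [← e1, ← hDs x]; ring
      rw [e2, add_mul, hs x, h2, Real.sin_add (n * x) (n * x + x), Real.sin_add, Real.cos_add]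
      linear_combination (-Real.sin (n * x) ^ 2) * Real.sin_sq_add_cos_sq x

lemma intervalIntegral_sin_quotient_sq_le (n : ℕ) :
    ∫ t in (0 : ℝ)..(n * (Real.pi / 2)), |Real.sin t / t| ^ 2 ≤ Real.pi / 2 := by
  rcases Nat.eq_zero_or_pos n with rfl | hn
  · simpa using Real.pi_div_two_pos.le
  have hn' : (0 : ℝ) < n := by exact_mod_cast hn
  obtain ⟨F, hF, hI, hs⟩ := exists_fejer_kernel n
  have hsub := intervalIntegral.mul_integral_comp_mul_left (a := 0) (b := Real.pi / 2)
    (f := fun t => |Real.sin t / t| ^ 2) (c := (n : ℝ))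
  rw [mul_zero] at hsub
  rw [← hsub]
  have hle : (∫ x in (0 : ℝ)..(Real.pi / 2), |Real.sin (n * x) / (n * x)| ^ 2) ≤
      ∫ x in (0 : ℝ)..(Real.pi / 2), F x / n ^ 2 := by
    refine intervalIntegral.integral_mono_on_of_le_Ioo (by positivity) ?_
      (Continuous.intervalIntegrable (by fun_prop) _ _) fun x hx => ?_
    · exact ((integrable_sin_quotient_pow le_rfl).comp_mul_left' hn'.ne').intervalIntegrable
    · have hsin : 0 < Real.sin x :=
        Real.sin_pos_of_pos_of_lt_pi hx.1 (by linarith [hx.2, Real.pi_pos])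
      have hx0 : 0 < x := hx.1
      have hF0 : 0 ≤ F x := by
        by_contra! h
        nlinarith [hs x, sq_nonneg (Real.sin (n * x)),
          mul_pos_of_neg_of_neg h (neg_neg_of_pos (pow_pos hsin 2))]
      have hq : Real.sin x ^ 2 ≤ x ^ 2 := Real.sin_sq_le_sq
      rw [sq_abs, div_pow, ← hs x, mul_pow, mul_comm ((n : ℝ) ^ 2), ← div_div]
      gcongr
      rw [div_le_iff₀ (by positivity)]
      gcongr
  calc _ ≤ (n : ℝ) * ∫ x in (0 : ℝ)..(Real.pi / 2), F x / n ^ 2 := by gcongr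
    _ = Real.pi / 2 := by
      rw [intervalIntegral.integral_div, hI]
      field_simp

lemma integral_sin_quotient_sq_le :
    ∫ t in Ioi (0 : ℝ), |Real.sin t / t| ^ 2 ≤ Real.pi / 2 := by
  have h := intervalIntegral_tendsto_integral_Ioi (0 : ℝ)
    (integrable_sin_quotient_pow le_rfl).integrableOn
    (tendsto_natCast_atTop_atTop.atTop_mul_const (by positivity : (0 : ℝ) < Real.pi / 2))
  exact le_of_tendsto' h intervalIntegral_sin_quotient_sq_le

lemma nonneg_of_hasDerivAt_nonneg {f f' : ℝ → ℝ} (hf : ∀ x, HasDerivAt f (f' x) x)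
    (h0 : f 0 = 0) (hf' : ∀ x, 0 ≤ x → 0 ≤ f' x) {x : ℝ} (hx : 0 ≤ x) : 0 ≤ f x := by
  have hm : MonotoneOn f (Ici 0) := by
    refine monotoneOn_of_hasDerivWithinAt_nonneg (convex_Ici 0)
      (fun x _ => (hf x).continuousAt.continuousWithinAt)
      (fun x _ => (hf x).hasDerivWithinAt) fun x hx => hf' x ?_
    rw [interior_Ici] at hx
    exact le_of_lt hx
  simpa [h0] using hm (mem_Ici.2 le_rfl) (mem_Ici.2 hx) hx

lemma cos_le_taylor_four {t : ℝ} (ht : 0 ≤ t) : Real.cos t ≤ 1 - t ^ 2 / 2 + t ^ 4 / 24 := by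
  have := nonneg_of_hasDerivAt_nonneg
    (f := fun t => 1 - t ^ 2 / 2 + t ^ 4 / 24 - Real.cos t)
    (f' := fun t => Real.sin t - (t - t ^ 3 / 6))
    (fun x => by
      have h := ((((hasDerivAt_const x (1 : ℝ)).sub ((hasDerivAt_pow 2 x).div_const 2)).add
        ((hasDerivAt_pow 4 x).div_const 24)).sub (Real.hasDerivAt_cos x))
      convert! h using 1
      push_cast; ring)
    (by simp) (fun x hx => by
      rcases hx.eq_or_lt with rfl | hx
      · simp
      · linarith [Real.sin_gt_sub_cube hx]) ht
  linarith

lemma sin_le_taylor_five {t : ℝ} (ht : 0 ≤ t) : Real.sin t ≤ t - t ^ 3 / 6 + t ^ 5 / 120 := by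
  have := nonneg_of_hasDerivAt_nonneg
    (f := fun t => t - t ^ 3 / 6 + t ^ 5 / 120 - Real.sin t)
    (f' := fun t => (1 - t ^ 2 / 2 + t ^ 4 / 24) - Real.cos t)
    (fun x => by
      have h := ((((hasDerivAt_id x)).sub ((hasDerivAt_pow 3 x).div_const 6)).add
        ((hasDerivAt_pow 5 x).div_const 120)).sub (Real.hasDerivAt_sin x)
      convert! h using 1
      push_cast; ring)
    (by simp) (fun x hx => by linarith [cos_le_taylor_four hx]) ht
  linarith

lemma taylor_six_le_cos {t : ℝ} (ht : 0 ≤ t) :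
    1 - t ^ 2 / 2 + t ^ 4 / 24 - t ^ 6 / 720 ≤ Real.cos t := by
  have := nonneg_of_hasDerivAt_nonneg
    (f := fun t => Real.cos t - (1 - t ^ 2 / 2 + t ^ 4 / 24 - t ^ 6 / 720))
    (f' := fun t => (t - t ^ 3 / 6 + t ^ 5 / 120) - Real.sin t)
    (fun x => by
      have h := (Real.hasDerivAt_cos x).sub
        ((((hasDerivAt_const x (1 : ℝ)).sub ((hasDerivAt_pow 2 x).div_const 2)).add
        ((hasDerivAt_pow 4 x).div_const 24)).sub ((hasDerivAt_pow 6 x).div_const 720))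
      convert! h using 1
      push_cast; ring)
    (by simp) (fun x hx => by linarith [sin_le_taylor_five hx]) ht
  linarith

lemma taylor_seven_le_sin {t : ℝ} (ht : 0 ≤ t) :
    t - t ^ 3 / 6 + t ^ 5 / 120 - t ^ 7 / 5040 ≤ Real.sin t := by
  have := nonneg_of_hasDerivAt_nonneg
    (f := fun t => Real.sin t - (t - t ^ 3 / 6 + t ^ 5 / 120 - t ^ 7 / 5040))
    (f' := fun t => Real.cos t - (1 - t ^ 2 / 2 + t ^ 4 / 24 - t ^ 6 / 720))
    (fun x => by
      have h := (Real.hasDerivAt_sin x).sub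
        ((((hasDerivAt_id x)).sub ((hasDerivAt_pow 3 x).div_const 6)).add
        ((hasDerivAt_pow 5 x).div_const 120) |>.sub ((hasDerivAt_pow 7 x).div_const 5040))
      convert! h using 1
      push_cast; ring)
    (by simp) (fun x hx => by linarith [taylor_six_le_cos hx]) ht
  linarith

lemma cos_le_taylor_eight {t : ℝ} (ht : 0 ≤ t) :
    Real.cos t ≤ 1 - t ^ 2 / 2 + t ^ 4 / 24 - t ^ 6 / 720 + t ^ 8 / 40320 := by
  have := nonneg_of_hasDerivAt_nonneg
    (f := fun t => 1 - t ^ 2 / 2 + t ^ 4 / 24 - t ^ 6 / 720 + t ^ 8 / 40320 - Real.cos t)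
    (f' := fun t => Real.sin t - (t - t ^ 3 / 6 + t ^ 5 / 120 - t ^ 7 / 5040))
    (fun x => by
      have h := ((((((hasDerivAt_const x (1 : ℝ)).sub ((hasDerivAt_pow 2 x).div_const 2)).add
        ((hasDerivAt_pow 4 x).div_const 24)).sub ((hasDerivAt_pow 6 x).div_const 720)).add
        ((hasDerivAt_pow 8 x).div_const 40320)).sub (Real.hasDerivAt_cos x))
      convert! h using 1
      push_cast; ring)
    (by simp) (fun x hx => by linarith [taylor_seven_le_sin hx]) ht
  linarith

lemma sin_le_taylor_nine {t : ℝ} (ht : 0 ≤ t) :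
    Real.sin t ≤ t - t ^ 3 / 6 + t ^ 5 / 120 - t ^ 7 / 5040 + t ^ 9 / 362880 := by
  have := nonneg_of_hasDerivAt_nonneg
    (f := fun t => t - t ^ 3 / 6 + t ^ 5 / 120 - t ^ 7 / 5040 + t ^ 9 / 362880 - Real.sin t)
    (f' := fun t => 1 - t ^ 2 / 2 + t ^ 4 / 24 - t ^ 6 / 720 + t ^ 8 / 40320 - Real.cos t)
    (fun x => by
      have h := (((((hasDerivAt_id x).sub ((hasDerivAt_pow 3 x).div_const 6)).add
        ((hasDerivAt_pow 5 x).div_const 120)).sub ((hasDerivAt_pow 7 x).div_const 5040)).add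
        ((hasDerivAt_pow 9 x).div_const 362880)).sub (Real.hasDerivAt_sin x)
      convert! h using 1
      push_cast; ring)
    (by simp) (fun x hx => by linarith [cos_le_taylor_eight hx]) ht
  linarith

/-- A function whose derivative dominates `sin t ^ 2 / t ^ 3` for positive `t`. -/
noncomputable def tailPrimitive (t : ℝ) : ℝ :=
  -(1 / 4) * t⁻¹ ^ 2 - 1 / 2 * (Real.sin t * Real.cos t) * t⁻¹ ^ 3
    - 3 / 4 * Real.sin t ^ 2 * t⁻¹ ^ 4

lemma hasDerivAt_tailPrimitive {t : ℝ} (ht : t ≠ 0) :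
    HasDerivAt tailPrimitive (Real.sin t ^ 2 * (t⁻¹ ^ 3 + 3 * t⁻¹ ^ 5)) t := by
  have hi := hasDerivAt_inv ht
  have hs := Real.hasDerivAt_sin t
  have hc := Real.hasDerivAt_cos t
  have h := (((hi.pow 2).const_mul (-(1 / 4))).sub
    (((hs.mul hc).const_mul (1 / 2)).mul (hi.pow 3))).sub
    (((hs.pow 2).const_mul (3 / 4)).mul (hi.pow 4))
  convert! h using 1
  simp only [Pi.pow_apply, Pi.mul_apply]
  push_cast
  rw [← inv_pow]
  linear_combination (1 / 2 * t⁻¹ ^ 3) * Real.sin_sq_add_cos_sq t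

lemma tendsto_tailPrimitive : Tendsto tailPrimitive atTop (𝓝 0) := by
  have hu : Tendsto (fun t : ℝ => t⁻¹) atTop (𝓝 0) := tendsto_inv_atTop_zero
  have h : Tendsto (fun t : ℝ => 1 / 4 * t⁻¹ ^ 2 + 1 / 2 * t⁻¹ ^ 3 + 3 / 4 * t⁻¹ ^ 4)
      atTop (𝓝 0) := by
    have := (((hu.pow 2).const_mul (1 / 4)).add ((hu.pow 3).const_mul (1 / 2))).add
      ((hu.pow 4).const_mul (3 / 4))
    norm_num at this ⊢
    exact this
  refine squeeze_zero_norm' ?_ h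
  filter_upwards [eventually_gt_atTop 0] with t ht
  have hu0 : 0 < t⁻¹ := inv_pos.2 ht
  have h1 : |Real.sin t * Real.cos t| ≤ 1 := by
    rw [abs_mul]
    exact mul_le_one₀ (Real.abs_sin_le_one t) (abs_nonneg _) (Real.abs_cos_le_one t)
  obtain ⟨h1l, h1r⟩ := abs_le.1 h1
  have h2 := Real.sin_sq_le_one t
  have h3 := sq_nonneg (Real.sin t)
  have a := mul_le_mul_of_nonneg_right h1l (pow_pos hu0 3).le
  have b := mul_le_mul_of_nonneg_right h1r (pow_pos hu0 3).le
  have c := mul_le_mul_of_nonneg_right h2 (pow_pos hu0 4).le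
  have d := mul_nonneg h3 (pow_pos hu0 4).le
  have e := pow_pos hu0 2
  rw [Real.norm_eq_abs, tailPrimitive, abs_le]
  constructor <;> linarith

lemma integral_sin_quotient_rpow_tail_le {p : ℝ} (hp : 3 ≤ p) :
    ∫ t in Ioi Real.pi, |Real.sin t / t| ^ p ≤ Real.pi ^ (3 - p) * (1 / (4 * Real.pi ^ 2)) := by
  have hpi := Real.pi_pos
  have hne : ∀ t ∈ Ici Real.pi, t ≠ 0 := fun t ht => (hpi.trans_le ht).ne'
  have hd : ∀ t ∈ Ici Real.pi, HasDerivAt tailPrimitive _ t :=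
    fun t ht => hasDerivAt_tailPrimitive (hne t ht)
  have hnn : ∀ t ∈ Ioi Real.pi, 0 ≤ Real.sin t ^ 2 * (t⁻¹ ^ 3 + 3 * t⁻¹ ^ 5) := fun t ht => by
    have : 0 < t := hpi.trans ht
    positivity
  have hint := integrableOn_Ioi_deriv_of_nonneg' hd hnn tendsto_tailPrimitive
  have hval := integral_Ioi_of_hasDerivAt_of_nonneg' hd hnn tendsto_tailPrimitive
  have hGpi : 0 - tailPrimitive Real.pi = 1 / (4 * Real.pi ^ 2) := by
    simp [tailPrimitive]
    ring
  rw [← hGpi, ← hval, ← integral_const_mul]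
  refine setIntegral_mono_on (integrable_sin_quotient_rpow (by linarith)).integrableOn
    (hint.const_mul _) measurableSet_Ioi fun t ht => ?_
  have ht0 : 0 < t := hpi.trans ht
  have hs1 := Real.abs_sin_le_one t
  have h1 : |Real.sin t| ^ p ≤ Real.sin t ^ 2 := by
    rw [← sq_abs, ← Real.rpow_natCast]
    exact Real.rpow_le_rpow_of_exponent_ge_of_imp (abs_nonneg _) hs1
      (by push_cast; linarith) (by intro _ h; linarith)
  have h2 : (t ^ p)⁻¹ ≤ Real.pi ^ (3 - p) * t⁻¹ ^ 3 := by
    have : (t ^ p)⁻¹ = t ^ (3 - p) * t⁻¹ ^ 3 := by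
      rw [← Real.rpow_neg ht0.le, inv_pow, ← Real.rpow_natCast t 3, ← Real.rpow_neg ht0.le,
        ← Real.rpow_add ht0]
      congr 1
      push_cast; ring
    rw [this]
    have := Real.rpow_le_rpow_of_nonpos hpi (le_of_lt ht) (by linarith : 3 - p ≤ 0)
    gcongr
  have h3 : Real.pi ^ (3 - p) * t⁻¹ ^ 3 ≤ Real.pi ^ (3 - p) * (t⁻¹ ^ 3 + 3 * t⁻¹ ^ 5) := by
    gcongr
    have : 0 < t⁻¹ ^ 5 := by positivity
    linarith
  rw [abs_div, abs_of_pos ht0, Real.div_rpow (abs_nonneg _) ht0.le, div_eq_mul_inv]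
  calc _ ≤ Real.sin t ^ 2 * (Real.pi ^ (3 - p) * (t⁻¹ ^ 3 + 3 * t⁻¹ ^ 5)) :=
        mul_le_mul h1 (h2.trans h3) (by positivity) (by positivity)
    _ = _ := by ring

/-- The Taylor polynomial of `sin t / t` of degree eight. -/
noncomputable def sincTaylor (t : ℝ) : ℝ :=
  1 - t ^ 2 / 6 + t ^ 4 / 120 - t ^ 6 / 5040 + t ^ 8 / 362880

lemma integral_sincTaylor_cubed : ∫ t in (0 : ℝ)..3, sincTaylor t ^ 3 ≤ 1.19 := by
  unfold sincTaylor
  ring_nf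
  simp (disch := exact Continuous.intervalIntegrable (by fun_prop) _ _) only
    [intervalIntegral.integral_add,
    intervalIntegral.integral_mul_const, integral_pow, intervalIntegral.integral_const]
  norm_num

lemma integral_sin_quotient_cubed_near_le :
    ∫ t in (0 : ℝ)..Real.pi, |Real.sin t / t| ^ 3 ≤ 1.1901 := by
  have hi : ∀ a b : ℝ, IntervalIntegrable (fun t : ℝ => |Real.sin t / t| ^ 3) volume a b :=
    fun a b => (integrable_sin_quotient_pow (by norm_num)).intervalIntegrable
  have hpi3 := Real.pi_gt_three
  have hpi4 := Real.pi_lt_d2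
  rw [← intervalIntegral.integral_add_adjacent_intervals (hi 0 3) (hi 3 Real.pi)]
  have h1 : ∫ t in (0 : ℝ)..3, |Real.sin t / t| ^ 3 ≤ ∫ t in (0 : ℝ)..3, sincTaylor t ^ 3 := by
    refine intervalIntegral.integral_mono_on_of_le_Ioo (by norm_num) (hi 0 3)
      (Continuous.intervalIntegrable (by unfold sincTaylor; fun_prop) _ _) fun t ht => ?_
    have ht0 : 0 < t := ht.1
    have hs : 0 ≤ Real.sin t := Real.sin_nonneg_of_nonneg_of_le_pi ht0.le (by linarith [ht.2])
    rw [abs_of_nonneg (by positivity)]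
    gcongr
    rw [div_le_iff₀ ht0, sincTaylor]
    linarith [sin_le_taylor_nine ht0.le]
  have h2 : ∫ t in (3 : ℝ)..Real.pi, |Real.sin t / t| ^ 3 ≤
      ∫ t in (3 : ℝ)..Real.pi, (0.05 : ℝ) ^ 3 := by
    refine intervalIntegral.integral_mono_on_of_le_Ioo hpi3.le (hi _ _)
      (Continuous.intervalIntegrable (by fun_prop) _ _) fun t ht => ?_
    gcongr
    have ht0 : 0 < t := by linarith [ht.1]
    rw [abs_div, abs_of_pos ht0, div_le_iff₀ ht0, ← Real.sin_pi_sub]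
    have h := Real.abs_sin_le_abs (x := Real.pi - t)
    rw [abs_of_pos (by linarith [ht.2] : 0 < Real.pi - t)] at h
    linarith [ht.1]
  rw [intervalIntegral.integral_const, smul_eq_mul] at h2
  norm_num at h2
  linarith [integral_sincTaylor_cubed]

lemma exp_neg_le_taylor_two {t : ℝ} (ht : 0 ≤ t) : Real.exp (-t) ≤ 1 - t + t ^ 2 / 2 := by
  have := nonneg_of_hasDerivAt_nonneg
    (f := fun t => 1 - t + t ^ 2 / 2 - Real.exp (-t))
    (f' := fun t => Real.exp (-t) - (1 - t))
    (fun x => by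
      have h := (((hasDerivAt_const x (1 : ℝ)).sub (hasDerivAt_id x)).add
        ((hasDerivAt_pow 2 x).div_const 2)).sub (hasDerivAt_neg x).exp
      convert! h using 1
      push_cast; ring)
    (by simp) (fun x _ => by linarith [Real.one_sub_le_exp_neg x]) ht
  linarith

lemma taylor_three_le_exp_neg {t : ℝ} (ht : 0 ≤ t) :
    1 - t + t ^ 2 / 2 - t ^ 3 / 6 ≤ Real.exp (-t) := by
  have := nonneg_of_hasDerivAt_nonneg
    (f := fun t => Real.exp (-t) - (1 - t + t ^ 2 / 2 - t ^ 3 / 6))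
    (f' := fun t => 1 - t + t ^ 2 / 2 - Real.exp (-t))
    (fun x => by
      have h := (hasDerivAt_neg x).exp.sub ((((hasDerivAt_const x (1 : ℝ)).sub
        (hasDerivAt_id x)).add ((hasDerivAt_pow 2 x).div_const 2)).sub
        ((hasDerivAt_pow 3 x).div_const 6))
      convert! h using 1
      push_cast; ring)
    (by simp) (fun x hx => by linarith [exp_neg_le_taylor_two hx]) ht
  linarith

lemma sin_quotient_le_exp {t : ℝ} (ht : 0 < t) (htpi : t ≤ Real.pi) :
    Real.sin t / t ≤ Real.exp (-(t ^ 2 / 6)) := by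
  rw [div_le_iff₀ ht]
  have hpi := Real.pi_lt_d2
  rcases le_total (t ^ 2) 7.2 with h | h
  · have hexp : 1 - t ^ 2 / 6 + (t ^ 2 / 6) ^ 2 / 2 - (t ^ 2 / 6) ^ 3 / 6 ≤
        Real.exp (-(t ^ 2 / 6)) := by
      linarith [taylor_three_le_exp_neg (by positivity : 0 ≤ t ^ 2 / 6)]
    have h5 := sin_le_taylor_five ht.le
    have h6 := mul_le_mul_of_nonneg_right hexp ht.le
    have h7 : 0 ≤ (7.2 - t ^ 2) * t ^ 5 := mul_nonneg (by linarith) (by positivity)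
    nlinarith
  · have h1 : 2.68 ≤ t := by nlinarith
    have h2 : Real.sin t ≤ Real.pi - t := by
      rw [← Real.sin_pi_sub]
      exact Real.sin_le (by linarith)
    have h3 : (0.18 : ℝ) ≤ Real.exp (-(t ^ 2 / 6)) := by
      have h4 : Real.exp (-(5 / 3)) ≤ Real.exp (-(t ^ 2 / 6)) := by
        rw [Real.exp_le_exp]
        nlinarith
      refine le_trans ?_ h4
      have h5 : Real.exp (5 / 3) ^ 3 = Real.exp 1 ^ 5 := by
        rw [← Real.exp_nat_mul, ← Real.exp_nat_mul]
        norm_num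
      have h6 : Real.exp 1 ^ 5 ≤ 2.7183 ^ 5 := by
        gcongr
        linarith [Real.exp_one_lt_d9]
      have h7 : Real.exp (5 / 3) ≤ 0.18⁻¹ := by
        refine le_of_pow_le_pow_left₀ three_ne_zero (by norm_num) ?_
        rw [h5]
        exact h6.trans (by norm_num)
      rw [Real.exp_neg]
      exact (le_inv_comm₀ (by norm_num) (Real.exp_pos _)).2 h7
    nlinarith

lemma integral_sin_quotient_rpow_eq_add {p : ℝ} (hp : 2 ≤ p) :
    ∫ t in Ioi (0 : ℝ), |Real.sin t / t| ^ p =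
      (∫ t in (0 : ℝ)..Real.pi, |Real.sin t / t| ^ p) +
        ∫ t in Ioi Real.pi, |Real.sin t / t| ^ p :=
  (intervalIntegral.integral_interval_add_Ioi (integrable_sin_quotient_rpow hp).integrableOn
    (integrable_sin_quotient_rpow hp).integrableOn).symm

lemma integral_sin_quotient_cubed_le :
    ∫ t in Ioi (0 : ℝ), |Real.sin t / t| ^ 3 ≤ Real.exp (-(1 / 4)) * (Real.pi / 2) := by
  have h1 := integral_sin_quotient_rpow_eq_add (p := 3) (by norm_num)
  have h2 := integral_sin_quotient_rpow_tail_le (p := 3) le_rfl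
  have h3 := integral_sin_quotient_cubed_near_le
  have e : ∀ y : ℝ, y ^ (3 : ℝ) = y ^ 3 := fun y => by
    rw [← Real.rpow_natCast]; norm_num
  simp only [e] at h1 h2
  rw [sub_self, Real.rpow_zero, one_mul] at h2
  have hpi := Real.pi_gt_d2
  have h4 : 1 / (4 * Real.pi ^ 2) ≤ 0.0254 := by
    rw [div_le_iff₀ (by positivity)]
    nlinarith
  have h5 := taylor_three_le_exp_neg (by norm_num : (0 : ℝ) ≤ 1 / 4)
  have h6 : (299 / 384 : ℝ) * 1.57 ≤ Real.exp (-(1 / 4)) * (Real.pi / 2) :=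
    mul_le_mul (by linarith) (by linarith) (by norm_num) (Real.exp_pos _).le
  linarith

/-- The case `2 ≤ p ≤ 3`, by interpolation between the exponents `2` and `3`. -/
lemma integral_sin_quotient_rpow_le_of_le_three {p : ℝ} (hp : 2 ≤ p) (hp3 : p ≤ 3) :
    ∫ t in Ioi (0 : ℝ), |Real.sin t / t| ^ p ≤ Real.pi / 2 * √(2 / p) := by
  have hpi := Real.pi_pos
  set c : ℝ := Real.exp (-(1 / 4)) with hc
  have hc0 : 0 < c := Real.exp_pos _
  have i2 := (integrable_sin_quotient_pow (n := 2) le_rfl).integrableOn (s := Ioi 0)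
  have i3 := (integrable_sin_quotient_pow (n := 3) (by norm_num)).integrableOn (s := Ioi 0)
  have hpt : ∀ t : ℝ, |Real.sin t / t| ^ p ≤
      c ^ (p - 2) * ((3 - p) * |Real.sin t / t| ^ 2 + (p - 2) / c * |Real.sin t / t| ^ 3) := by
    intro t
    have hy : 0 ≤ |Real.sin t / t| := abs_nonneg _
    set y := |Real.sin t / t|
    have h1 : y ^ p = c ^ (p - 2) * (y ^ 2 * (y / c) ^ (p - 2)) := by
      rw [Real.div_rpow hy hc0.le]
      have : y ^ p = y ^ 2 * y ^ (p - 2) := by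
        rw [← Real.rpow_natCast y 2, ← Real.rpow_add_of_nonneg hy (by norm_num) (by linarith)]
        congr 1
        push_cast; ring
      rw [this]
      have : 0 < c ^ (p - 2) := Real.rpow_pos_of_pos hc0 _
      field_simp
    have h2 : (y / c) ^ (p - 2) ≤ 1 + (p - 2) * (y / c - 1) := by
      have := rpow_one_add_le_one_add_mul_self (s := y / c - 1) (p := p - 2)
        (by linarith [div_nonneg hy hc0.le]) (by linarith) (by linarith)
      rwa [add_sub_cancel] at this
    rw [h1]
    gcongr
    calc y ^ 2 * (y / c) ^ (p - 2) ≤ y ^ 2 * (1 + (p - 2) * (y / c - 1)) := by gcongr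
      _ = _ := by field_simp; ring
  have hI : ∫ t in Ioi (0 : ℝ), |Real.sin t / t| ^ p ≤
      c ^ (p - 2) * ((3 - p) * (∫ t in Ioi (0 : ℝ), |Real.sin t / t| ^ 2) +
        (p - 2) / c * ∫ t in Ioi (0 : ℝ), |Real.sin t / t| ^ 3) := by
    rw [← integral_const_mul (3 - p), ← integral_const_mul ((p - 2) / c),
      ← integral_add (i2.const_mul _) (i3.const_mul _), ← integral_const_mul]
    exact integral_mono (integrable_sin_quotient_rpow hp).integrableOn
      (((i2.const_mul _).add (i3.const_mul _)).const_mul _) hpt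
  have hexp : c ^ (p - 2) ≤ √(2 / p) := by
    apply Real.le_sqrt_of_sq_le
    rw [hc, ← Real.exp_mul, ← Real.exp_nat_mul]
    have : ((2 : ℕ) : ℝ) * (-(1 / 4) * (p - 2)) = -(p / 2 - 1) := by push_cast; ring
    rw [this, Real.exp_neg, ← inv_div p 2]
    exact inv_anti₀ (by positivity) (by linarith [Real.add_one_le_exp (p / 2 - 1)])
  calc _ ≤ c ^ (p - 2) * ((3 - p) * (Real.pi / 2) + (p - 2) / c * (c * (Real.pi / 2))) := by
        refine hI.trans ?_
        have : 0 ≤ 3 - p := by linarith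
        have : 0 ≤ p - 2 := by linarith
        gcongr
        · exact integral_sin_quotient_sq_le
        · exact integral_sin_quotient_cubed_le
    _ = Real.pi / 2 * c ^ (p - 2) := by field_simp; ring
    _ ≤ _ := by gcongr

/-- The case `3 ≤ p`, by comparison with a Gaussian on `(0, π)`. -/
lemma integral_sin_quotient_rpow_le_of_three_le {p : ℝ} (hp : 3 ≤ p) :
    ∫ t in Ioi (0 : ℝ), |Real.sin t / t| ^ p ≤ Real.pi / 2 * √(2 / p) := by
  have hpi := Real.pi_pos
  have hp0 : 0 < p := by linarith
  have hint := integrable_sin_quotient_rpow (p := p) (by linarith)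
  have hg := integrable_exp_neg_mul_sq (b := p / 6) (by positivity)
  have h1 : ∫ t in (0 : ℝ)..Real.pi, |Real.sin t / t| ^ p ≤ √(Real.pi / (p / 6)) / 2 := by
    rw [← integral_gaussian_Ioi, intervalIntegral.integral_of_le hpi.le]
    refine le_trans (setIntegral_mono_on (g := fun t => Real.exp (-(p / 6) * t ^ 2))
      hint.integrableOn hg.integrableOn measurableSet_Ioc fun t ht => ?_)
      (setIntegral_mono_set hg.integrableOn (ae_of_all _ fun t => (Real.exp_pos _).le)
        (ae_of_all _ fun t ht => ht.1))
    have hs : 0 ≤ Real.sin t := Real.sin_nonneg_of_nonneg_of_le_pi ht.1.le ht.2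
    have hst : 0 ≤ Real.sin t / t := div_nonneg hs ht.1.le
    rw [abs_of_nonneg hst]
    calc (Real.sin t / t) ^ p ≤ Real.exp (-(t ^ 2 / 6)) ^ p := by
          gcongr
          exact sin_quotient_le_exp ht.1 ht.2
      _ = _ := by
          rw [← Real.exp_mul]
          congr 1
          ring
  have h2 := integral_sin_quotient_rpow_tail_le hp
  have h3 : √(p / 3) * Real.pi ^ (3 - p) ≤ 1 := by
    have a : √(p / 3) ≤ p / 3 := by
      rw [Real.sqrt_le_left (by positivity)]
      nlinarith
    have b : p / 3 ≤ Real.exp (p - 3) := by linarith [Real.add_one_le_exp (p - 3)]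
    have d : Real.pi ^ (3 - p) ≤ Real.exp (-(p - 3)) := by
      rw [show -(p - 3) = 3 - p by ring, ← Real.exp_one_rpow]
      exact Real.rpow_le_rpow_of_nonpos (Real.exp_pos _)
        (by linarith [Real.exp_one_lt_d9, Real.pi_gt_three]) (by linarith)
    calc _ ≤ Real.exp (p - 3) * Real.exp (-(p - 3)) :=
          mul_le_mul (a.trans b) d (by positivity) (by positivity)
      _ = 1 := by rw [← Real.exp_add]; simp
  have hs : 0 < √p := Real.sqrt_pos.2 hp0
  have h4 : 1 / (4 * Real.pi ^ 2) ≤ 0.0254 := by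
    rw [div_le_iff₀ (by positivity)]
    nlinarith [Real.pi_gt_d2]
  have hsix : √(Real.pi / (p / 6)) = √(6 * Real.pi) / √p := by
    rw [← Real.sqrt_div (by positivity)]
    congr 1
    field_simp
  have hthird : √(p / 3) = √p / √3 := Real.sqrt_div hp0.le 3
  have hhalf : √(2 / p) = √2 / √p := Real.sqrt_div (by norm_num) p
  rw [integral_sin_quotient_rpow_eq_add (by linarith), hhalf]
  rw [hsix] at h1
  rw [hthird] at h3
  have k3 : √3 ≤ 1.7321 := Real.sqrt_le_iff.2 (by norm_num)
  have k2 : 1.41421 ≤ √2 := Real.le_sqrt_of_sq_le (by norm_num)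
  have k6 : √(6 * Real.pi) ≤ 4.3417 := by
    refine Real.sqrt_le_iff.2 ⟨by norm_num, ?_⟩
    linarith [Real.pi_lt_d4]
  have h5 : Real.pi ^ (3 - p) ≤ √3 / √p := by
    rw [le_div_iff₀ hs]
    have : (0 : ℝ) < √3 := by positivity
    have h6 : √p / √3 * Real.pi ^ (3 - p) = Real.pi ^ (3 - p) * √p / √3 := by ring
    rw [h6, div_le_one this] at h3
    exact h3
  calc _ ≤ √(6 * Real.pi) / √p / 2 + √3 / √p * 0.0254 := by
        refine add_le_add h1 (h2.trans ?_)
        gcongr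
    _ = (√(6 * Real.pi) / 2 + √3 * 0.0254) / √p := by ring
    _ ≤ (Real.pi / 2 * √2) / √p := by
        gcongr
        nlinarith [Real.pi_gt_d4]
    _ = _ := by ring

theorem ball_integral_inequality (p : ℝ) (hp : 2 ≤ p) :
    (1 / Real.pi) * ∫ t : ℝ, |Real.sin t / t| ^ p ≤ Real.sqrt (2 / p) := by
  have hpi := Real.pi_pos
  have habs : ∀ t : ℝ, |Real.sin t / t| = abs (Real.sin |t| / |t|) := fun t => by
    rcases abs_choice t with h | h <;> simp [h]
  have heven : ∫ t : ℝ, |Real.sin t / t| ^ p =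
      2 * ∫ t in Ioi (0 : ℝ), |Real.sin t / t| ^ p := by
    rw [← integral_comp_abs (f := fun t => |Real.sin t / t| ^ p)]
    simp_rw [← habs]
  have hmain : ∫ t in Ioi (0 : ℝ), |Real.sin t / t| ^ p ≤ Real.pi / 2 * √(2 / p) := by
    rcases le_total p 3 with h | h
    · exact integral_sin_quotient_rpow_le_of_le_three hp h
    · exact integral_sin_quotient_rpow_le_of_three_le h
  rw [heven, one_div, inv_mul_le_iff₀ hpi]
  linarith
end

section
/- Let $u_1,\ldots,u_m$ be unit vectors in $\mathbb{R}^n$ with $m \ge n$, and let $c_1,\ldots,c_m > 0$ satisfy $\sum_{i=1}^m c_i\, u_i \otimes u_i = I_n$. Then for all nonnegative integrable functions $f_1,\ldots,f_m : \mathbb{R} \to [0,\infty)$, $\int_{\mathbb{R}^n} \prod_{i=1}^m f_i(\langle u_i, x\rangle)^{c_i}\, dx \le \prod_{i=1}^m \left(\int_{\mathbb{R}} f_i\right)^{c_i}$. -/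
open MeasureTheory
open scoped RealInnerProductSpace

/-- The derivative of a cumulative integral, at almost every point. -/
lemma ae_hasDerivAt_setIntegral_Iic {f : ℝ → ℝ} (hf : Integrable f) :
    ∀ᵐ t, HasDerivAt (fun x => ∫ s in Set.Iic x, f s) (f t) t := by
  filter_upwards [LocallyIntegrable.ae_hasDerivAt_integral hf.locallyIntegrable] with t ht
  refine ((ht 0).const_add (∫ s in Set.Iic 0, f s)).congr_of_eventuallyEq (.of_forall fun x => ?_)
  simp only
  rw [← intervalIntegral.integral_Iic_sub_Iic hf.integrableOn hf.integrableOn]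
  ring

/-- The cumulative integral of a continuous function is strictly differentiable. -/
lemma hasStrictDerivAt_setIntegral_Iic {f : ℝ → ℝ} (hf : Integrable f) (hc : Continuous f)
    (t : ℝ) : HasStrictDerivAt (fun x => ∫ s in Set.Iic x, f s) (f t) t := by
  have h := (hc.integral_hasStrictDerivAt 0 t).const_add (∫ s in Set.Iic 0, f s)
  refine h.congr_of_eventuallyEq (.of_forall fun x => ?_)
  simp only
  rw [← intervalIntegral.integral_Iic_sub_Iic hf.integrableOn hf.integrableOn]
  ring

lemma monotone_setIntegral_Iic {f : ℝ → ℝ} (hf : Integrable f) (h0 : ∀ t, 0 ≤ f t) :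
    Monotone (fun x => ∫ s in Set.Iic x, f s) := fun _ _ hxy =>
  setIntegral_mono_set hf.integrableOn (.of_forall h0)
    (Set.Iic_subset_Iic.2 hxy).eventuallyLE

/-- A monotone function is strictly monotone on any set on which its derivative is positive. -/
lemma Monotone.strictMonoOn_of_hasDerivAt_pos {F f' : ℝ → ℝ} {s : Set ℝ} (hF : Monotone F)
    (hd : ∀ t ∈ s, HasDerivAt F (f' t) t) (hpos : ∀ t ∈ s, 0 < f' t) : StrictMonoOn F s := by
  intro a ha b _ hab
  refine (hF hab.le).lt_of_ne fun h => (hpos a ha).ne' ?_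
  have h1 : HasDerivWithinAt F 0 (Set.Ici a) a := by
    refine (hasDerivWithinAt_const a (Set.Ici a) (F a)).congr_of_eventuallyEq ?_ rfl
    filter_upwards [Ico_mem_nhdsGE hab] with x hx
    exact le_antisymm (h ▸ hF hx.2.le) (hF hx.1)
  exact (uniqueDiffWithinAt_Ici a).eq_deriv _ (hd a ha).hasDerivWithinAt h1

/-- Monotone transport of a nonnegative integrable function on the line to the standard
Gaussian `exp (-π x ^ 2)`. -/
lemma exists_transport_gaussian {f : ℝ → ℝ} (hf : Integrable f) (h0 : ∀ t, 0 ≤ f t) :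
    ∃ (S : Set ℝ) (T T' : ℝ → ℝ), MeasurableSet S ∧ (∀ᵐ t, t ∉ S → f t = 0) ∧
      StrictMonoOn T S ∧ ∀ t ∈ S, HasDerivAt T (T' t) t ∧ 0 < T' t ∧
        f t = (∫ s, f s) * (Real.exp (-Real.pi * T t ^ 2) * T' t) := by
  set I := ∫ s, f s with hI
  rcases (integral_nonneg h0 : 0 ≤ I).eq_or_lt with hI0 | hI0
  · refine ⟨∅, id, id, .empty, ?_, by simp [StrictMonoOn], by simp⟩
    have := (integral_eq_zero_iff_of_nonneg h0 hf).1 hI0.symm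
    filter_upwards [this] with t ht _ using ht
  set g : ℝ → ℝ := fun x => Real.exp (-Real.pi * x ^ 2) with hg
  have gc : Continuous g := by fun_prop
  have gi : Integrable g := integrable_exp_neg_mul_sq Real.pi_pos
  have g1 : ∫ x, g x = 1 := by
    rw [hg, integral_gaussian, div_self Real.pi_ne_zero, Real.sqrt_one]
  have gpos : ∀ x, 0 < g x := fun x => Real.exp_pos _
  set Φ : ℝ → ℝ := fun x => ∫ s in Set.Iic x, g s with hΦ
  have Φd := hasStrictDerivAt_setIntegral_Iic gi gc
  have Φm : StrictMono Φ := by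
    rw [← strictMonoOn_univ]
    exact (monotone_setIntegral_Iic gi fun x => (gpos x).le).strictMonoOn_of_hasDerivAt_pos
      (fun t _ => (Φd t).hasDerivAt) fun t _ => gpos t
  have Φc : Continuous Φ := continuous_iff_continuousAt.2 fun t => (Φd t).hasDerivAt.continuousAt
  have Φe : Topology.IsOpenEmbedding Φ := .of_continuous_injective_isOpenMap Φc Φm.injective
    (isOpenMap_of_hasStrictDerivAt Φd fun x => (gpos x).ne')
  have Φbot : Filter.Tendsto Φ Filter.atBot (nhds 0) := tendsto_integral_Iic_zero Filter.tendsto_id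
  have Φtop : Filter.Tendsto Φ Filter.atTop (nhds 1) := by
    rw [← g1]
    exact (aecover_Iic Filter.tendsto_id).integral_tendsto_of_countably_generated gi
  have Φrange : Set.Ioo 0 1 ⊆ Set.range Φ := by
    intro y hy
    obtain ⟨a, ha⟩ := (Φbot.eventually_lt_const hy.1).exists
    obtain ⟨b, hb⟩ := (Φtop.eventually_const_lt hy.2).exists
    exact mem_range_of_exists_le_of_exists_ge Φc ⟨a, ha.le⟩ ⟨b, hb.le⟩
  set e := Φe.toOpenPartialHomeomorph Φ with he
  set F : ℝ → ℝ := fun x => (∫ s in Set.Iic x, f s) / I with hF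
  have Fm : Monotone F := fun x y hxy => by
    have := monotone_setIntegral_Iic hf h0 hxy
    simp only [hF]
    gcongr
  have F0 : ∀ t, 0 ≤ F t := fun t => div_nonneg (integral_nonneg h0) hI0.le
  have F1 : ∀ t, F t ≤ 1 := fun t => by
    rw [div_le_one hI0]
    exact setIntegral_le_integral hf (.of_forall h0)
  have hnull : NullMeasurableSet {t | 0 < f t} :=
    nullMeasurableSet_lt aemeasurable_const hf.aemeasurable
  have hae := ae_hasDerivAt_setIntegral_Iic hf
  obtain ⟨D, hDs, hDm, hD0⟩ := exists_measurable_superset_of_null (ae_iff.1 hae)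
  obtain ⟨P, hPs, hPm, hPe⟩ := hnull.exists_measurable_subset_ae_eq
  set S := P \ D with hS
  have Fd : ∀ t ∈ S, HasDerivAt F (f t / I) t := fun t ht => by
    have : HasDerivAt (fun x => ∫ s in Set.Iic x, f s) (f t) t := by
      by_contra h
      exact ht.2 (hDs h)
    exact this.div_const I
  have fpos : ∀ t ∈ S, 0 < f t := fun t ht => hPs ht.1
  have Fd0 : ∀ t ∈ S, 0 < f t / I := fun t ht => div_pos (fpos t ht) hI0
  have Fs : StrictMonoOn F S := Fm.strictMonoOn_of_hasDerivAt_pos Fd Fd0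
  have Ft : ∀ t ∈ S, F t ∈ e.target := fun t ht => by
    have : F t ∈ Set.range Φ := by
      refine Φrange ⟨(F0 t).lt_of_ne fun h => (Fd0 t ht).ne' ?_,
        (F1 t).lt_of_ne fun h => (Fd0 t ht).ne' ?_⟩
      · exact IsLocalMin.hasDerivAt_eq_zero (.of_forall fun x => h ▸ F0 x) (Fd t ht)
      · exact IsLocalMax.hasDerivAt_eq_zero (.of_forall fun x => h.symm ▸ F1 x) (Fd t ht)
    simpa [he] using this
  have eΦ : ∀ y ∈ e.target, Φ (e.symm y) = y := fun y hy => by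
    simpa [he] using e.right_inv hy
  refine ⟨S, fun t => e.symm (F t), fun t => (g (e.symm (F t)))⁻¹ * (f t / I), hPm.diff hDm,
    ?_, ?_, fun t ht => ⟨?_, ?_, ?_⟩⟩
  · filter_upwards [hPe.mem_iff, measure_eq_zero_iff_ae_notMem.1 hD0] with t h1 h2 h3
    have : t ∉ P := fun h => h3 ⟨h, h2⟩
    rw [h1] at this
    exact le_antisymm (not_lt.1 this) (h0 t)
  · intro a ha b hb hab
    rw [← Φm.lt_iff_lt, eΦ _ (Ft a ha), eΦ _ (Ft b hb)]
    exact Fs ha hb hab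
  · have h1 := e.hasDerivAt_symm (Ft t ht) (gpos _).ne' (by
      simpa [he] using (Φd (e.symm (F t))).hasDerivAt)
    exact h1.comp t (Fd t ht)
  · exact mul_pos (inv_pos.2 (gpos _)) (Fd0 t ht)
  · change f t = I * (g (e.symm (F t)) * ((g (e.symm (F t)))⁻¹ * (f t / I)))
    rw [mul_inv_cancel_left₀ (gpos _).ne', mul_div_cancel₀ _ hI0.ne']

section Frame

variable {E ι : Type*} [NormedAddCommGroup E] [InnerProductSpace ℝ E] [Fintype ι]

/-- The operator `∑ i, a i • u i ⊗ u i`. -/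
noncomputable def frameOperator (u : ι → E) (a : ι → ℝ) : E →L[ℝ] E :=
  ∑ i, a i • (innerSL ℝ (u i)).smulRight (u i)

lemma frameOperator_apply (u : ι → E) (a : ι → ℝ) (x : E) :
    frameOperator u a x = ∑ i, (a i * ⟪u i, x⟫) • u i := by
  simp [frameOperator, smul_smul]

lemma inner_frameOperator (u : ι → E) (a : ι → ℝ) (x y : E) :
    ⟪x, frameOperator u a y⟫ = ∑ i, a i * ⟪u i, x⟫ * ⟪u i, y⟫ := by
  rw [frameOperator_apply, inner_sum]
  refine Finset.sum_congr rfl fun i _ => ?_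
  rw [inner_smul_right, real_inner_comm x (u i)]
  ring

lemma isSymmetric_frameOperator (u : ι → E) (a : ι → ℝ) :
    (frameOperator u a : E →ₗ[ℝ] E).IsSymmetric := fun x y => by
  simp only [ContinuousLinearMap.coe_coe]
  rw [real_inner_comm, inner_frameOperator, inner_frameOperator]
  exact Finset.sum_congr rfl fun i _ => by ring

variable {u : ι → E} {c : ι → ℝ}

lemma sum_mul_inner_sq (hdecomp : ∀ x : E, ∑ i, (c i * ⟪u i, x⟫) • u i = x) (x : E) :
    ∑ i, c i * ⟪u i, x⟫ ^ 2 = ‖x‖ ^ 2 := by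
  have h := inner_frameOperator u c x x
  rw [frameOperator_apply, hdecomp, real_inner_self_eq_norm_sq] at h
  rw [h]
  exact Finset.sum_congr rfl fun i _ => by ring

lemma norm_sq_sum_smul_le (hc : ∀ i, 0 < c i)
    (hdecomp : ∀ x : E, ∑ i, (c i * ⟪u i, x⟫) • u i = x) (s : ι → ℝ) :
    ‖∑ i, (c i * s i) • u i‖ ^ 2 ≤ ∑ i, c i * s i ^ 2 := by
  set y := ∑ i, (c i * s i) • u i with hy
  have h1 : ‖y‖ ^ 2 = ∑ i, c i * (s i * ⟪u i, y⟫) := by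
    rw [← real_inner_self_eq_norm_sq]
    nth_rw 1 [hy]
    rw [sum_inner]
    exact Finset.sum_congr rfl fun i _ => by rw [inner_smul_left]; simp [mul_assoc]
  have h2 : ∑ i, c i * (s i * ⟪u i, y⟫) ≤ ∑ i, (c i * s i ^ 2 + c i * ⟪u i, y⟫ ^ 2) / 2 := by
    refine Finset.sum_le_sum fun i _ => ?_
    nlinarith [mul_nonneg (hc i).le (sq_nonneg (s i - ⟪u i, y⟫))]
  rw [← Finset.sum_div, Finset.sum_add_distrib, sum_mul_inner_sq hdecomp] at h2
  linarith

lemma prod_rpow_le_det_frameOperator [FiniteDimensional ℝ E] (hu : ∀ i, ‖u i‖ = 1)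
    (hc : ∀ i, 0 < c i) (hdecomp : ∀ x : E, ∑ i, (c i * ⟪u i, x⟫) • u i = x)
    {t : ι → ℝ} (ht : ∀ i, 0 < t i) :
    ∏ i, t i ^ c i ≤ (frameOperator u fun i => c i * t i).det := by
  have hs := isSymmetric_frameOperator u fun i => c i * t i
  set b := hs.eigenvectorBasis rfl with hb
  have hval : ∀ j, hs.eigenvalues rfl j = ∑ i, (c i * ⟪u i, b j⟫ ^ 2) * t i := fun j => by
    have h := inner_frameOperator u (fun i => c i * t i) (b j) (b j)
    have h2 := hs.apply_eigenvectorBasis rfl j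
    rw [← hb] at h2
    simp only [ContinuousLinearMap.coe_coe] at h2
    rw [h2, inner_smul_right, real_inner_self_eq_norm_sq, b.norm_eq_one] at h
    simp only [RCLike.ofReal_real_eq_id, id_eq, one_pow, mul_one] at h
    rw [h]
    exact Finset.sum_congr rfl fun i _ => by ring
  have hle : ∀ j, ∏ i, t i ^ (c i * ⟪u i, b j⟫ ^ 2) ≤ hs.eigenvalues rfl j := fun j => by
    rw [hval]
    refine Real.geom_mean_le_arith_mean_weighted _ _ _
      (fun i _ => mul_nonneg (hc i).le (sq_nonneg _)) ?_ fun i _ => (ht i).le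
    rw [sum_mul_inner_sq hdecomp, b.norm_eq_one, one_pow]
  have hdet : (frameOperator u fun i => c i * t i).det = ∏ j, hs.eigenvalues rfl j := by
    simpa using hs.det_eq_prod_eigenvalues rfl
  rw [hdet]
  calc ∏ i, t i ^ c i = ∏ i, ∏ j, t i ^ (c i * ⟪u i, b j⟫ ^ 2) := by
        refine Finset.prod_congr rfl fun i _ => ?_
        rw [← Real.rpow_sum_of_pos (ht i), ← Finset.mul_sum]
        have := b.sum_sq_norm_inner_left (u i)
        simp only [Real.norm_eq_abs, sq_abs, hu, one_pow] at this
        rw [this, mul_one]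
    _ = ∏ j, ∏ i, t i ^ (c i * ⟪u i, b j⟫ ^ 2) := Finset.prod_comm
    _ ≤ _ := Finset.prod_le_prod
        (fun j _ => Finset.prod_nonneg fun i _ => Real.rpow_nonneg (ht i).le _) fun j _ => hle j

end Frame

/-- The Brascamp–Lieb inequality for lower Lebesgue integrals. -/
lemma lintegral_prod_rpow_inner_le {E ι : Type*} [NormedAddCommGroup E] [InnerProductSpace ℝ E]
    [FiniteDimensional ℝ E] [MeasurableSpace E] [BorelSpace E] [Fintype ι]
    {u : ι → E} (hu : ∀ i, ‖u i‖ = 1) {c : ι → ℝ} (hc : ∀ i, 0 < c i)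
    (hdecomp : ∀ x : E, ∑ i, (c i * ⟪u i, x⟫) • u i = x)
    {f : ι → ℝ → ℝ} (hf : ∀ i, Integrable (f i)) (h0 : ∀ i t, 0 ≤ f i t) :
    ∫⁻ x : E, ENNReal.ofReal (∏ i, f i ⟪u i, x⟫ ^ c i) ≤
      ENNReal.ofReal (∏ i, (∫ t, f i t) ^ c i) := by
  choose S T T' hSm hS0 hT hT' using fun i => exists_transport_gaussian (hf i) (h0 i)
  set Q : ℝ := ∏ i, (∫ t, f i t) ^ c i with hQ
  have hQ0 : 0 ≤ Q := Finset.prod_nonneg fun i _ => Real.rpow_nonneg (integral_nonneg (h0 i)) _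
  set A : Set E := ⋂ i, (fun x => ⟪u i, x⟫) ⁻¹' S i with hA
  have hAm : MeasurableSet A :=
    .iInter fun i => (by fun_prop : Measurable fun x : E => ⟪u i, x⟫) (hSm i)
  have hAS : ∀ x ∈ A, ∀ i, ⟪u i, x⟫ ∈ S i := fun x hx i => Set.mem_iInter.1 hx i
  set Θ : E → E := fun x => ∑ i, (c i * T i ⟪u i, x⟫) • u i with hΘ
  set Θ' : E → E →L[ℝ] E := fun x => frameOperator u fun i => c i * T' i ⟪u i, x⟫ with hΘ'
  have hderiv : ∀ x ∈ A, HasFDerivWithinAt Θ (Θ' x) A x := fun x hx => by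
    refine HasFDerivAt.hasFDerivWithinAt ?_
    refine HasFDerivAt.fun_sum fun i _ => ?_
    have h1 := ((hT' i _ (hAS x hx i)).1.comp_hasFDerivAt x
      (innerSL ℝ (u i)).hasFDerivAt).const_mul (c i) |>.smul_const (u i)
    refine h1.congr_fderiv ?_
    ext y
    simp [smul_smul, mul_assoc]
  have hinj : Set.InjOn Θ A := by
    intro x hx y hy hxy
    have h1 : ∑ i, c i * ((T i ⟪u i, x⟫ - T i ⟪u i, y⟫) * (⟪u i, x⟫ - ⟪u i, y⟫)) = 0 := by
      have : ⟪Θ x - Θ y, x - y⟫ = 0 := by rw [hxy, sub_self, inner_zero_left]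
      rw [← this, hΘ]
      simp only
      rw [← Finset.sum_sub_distrib, sum_inner]
      refine Finset.sum_congr rfl fun i _ => ?_
      rw [← sub_smul, inner_smul_left, inner_sub_right]
      simp only [conj_trivial]
      ring
    have hnn : ∀ i, 0 ≤ (T i ⟪u i, x⟫ - T i ⟪u i, y⟫) * (⟪u i, x⟫ - ⟪u i, y⟫) := fun i => by
      rcases le_total ⟪u i, x⟫ ⟪u i, y⟫ with h | h
      · exact mul_nonneg_of_nonpos_of_nonpos
          (sub_nonpos.2 ((hT i).monotoneOn (hAS x hx i) (hAS y hy i) h)) (sub_nonpos.2 h)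
      · exact mul_nonneg
          (sub_nonneg.2 ((hT i).monotoneOn (hAS y hy i) (hAS x hx i) h)) (sub_nonneg.2 h)
    rw [Finset.sum_eq_zero_iff_of_nonneg fun i _ => mul_nonneg (hc i).le (hnn i)] at h1
    have h2 : ∀ i, ⟪u i, x⟫ = ⟪u i, y⟫ := fun i => by
      rcases mul_eq_zero.1 ((mul_eq_zero.1 (h1 i (Finset.mem_univ i))).resolve_left (hc i).ne')
        with h | h
      · exact (hT i).injOn (hAS x hx i) (hAS y hy i) (sub_eq_zero.1 h)
      · exact sub_eq_zero.1 h
    rw [← hdecomp x, ← hdecomp y]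
    simp only [h2]
  have hoff : ∀ᵐ x : E, x ∉ A → ENNReal.ofReal (∏ i, f i ⟪u i, x⟫ ^ c i) = 0 := by
    have h1 : ∀ᵐ x : E, ∀ i, ⟪u i, x⟫ ∉ S i → f i ⟪u i, x⟫ = 0 := by
      refine ae_all_iff.2 fun i => ?_
      obtain ⟨N, hNs, hNm, hN0⟩ := exists_measurable_superset_of_null (ae_iff.1 (hS0 i))
      have hsurj : Function.Surjective (innerₛₗ ℝ (u i)) := fun r =>
        ⟨r • u i, by simp [hu]⟩
      have h2 := (ae_comp_linearMap_mem_iff (innerₛₗ ℝ (u i)) (volume : Measure E)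
        (volume : Measure ℝ) hsurj hNm.compl).2 (measure_eq_zero_iff_ae_notMem.1 hN0)
      filter_upwards [h2] with x hx
      by_contra h
      exact hx (hNs h)
    filter_upwards [h1] with x hx hxA
    obtain ⟨i, hi⟩ : ∃ i, ⟪u i, x⟫ ∉ S i := by simpa [hA] using hxA
    rw [Finset.prod_eq_zero (Finset.mem_univ i), ENNReal.ofReal_zero]
    rw [hx i hi, Real.zero_rpow (hc i).ne']
  have hpt : ∀ x ∈ A, ENNReal.ofReal (∏ i, f i ⟪u i, x⟫ ^ c i) ≤
      ENNReal.ofReal |(Θ' x).det| * ENNReal.ofReal (Q * Real.exp (-Real.pi * ‖Θ x‖ ^ 2)) := by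
    intro x hx
    rw [← ENNReal.ofReal_mul (abs_nonneg _)]
    refine ENNReal.ofReal_le_ofReal ?_
    have hpos : ∀ i, 0 < T' i ⟪u i, x⟫ := fun i => (hT' i _ (hAS x hx i)).2.1
    have h1 : ∏ i, f i ⟪u i, x⟫ ^ c i = Q *
        (Real.exp (-Real.pi * ∑ i, c i * T i ⟪u i, x⟫ ^ 2) * ∏ i, T' i ⟪u i, x⟫ ^ c i) := by
      rw [Finset.mul_sum, Real.exp_sum, hQ, ← Finset.prod_mul_distrib, ← Finset.prod_mul_distrib]
      refine Finset.prod_congr rfl fun i _ => ?_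
      rw [(hT' i _ (hAS x hx i)).2.2, Real.mul_rpow (integral_nonneg (h0 i))
        (mul_pos (Real.exp_pos _) (hpos i)).le, Real.mul_rpow (Real.exp_pos _).le (hpos i).le,
        ← Real.exp_mul]
      congr 3
      ring_nf
    have h2 := (prod_rpow_le_det_frameOperator hu hc hdecomp hpos).trans (le_abs_self _)
    have h3 := norm_sq_sum_smul_le hc hdecomp fun i => T i ⟪u i, x⟫
    have h4 : Real.exp (-Real.pi * ∑ i, c i * T i ⟪u i, x⟫ ^ 2) ≤
        Real.exp (-Real.pi * ‖Θ x‖ ^ 2) :=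
      Real.exp_le_exp.2 (mul_le_mul_of_nonpos_left h3 (neg_nonpos.2 Real.pi_pos.le))
    rw [h1, mul_comm |(Θ' x).det|, mul_assoc]
    exact mul_le_mul_of_nonneg_left (mul_le_mul h4 h2
      (Finset.prod_nonneg fun i _ => Real.rpow_nonneg (hpos i).le _) (Real.exp_pos _).le) hQ0
  have hgi : ∫ y : E, Real.exp (-Real.pi * ‖y‖ ^ 2) = 1 := by
    rw [GaussianFourier.integral_rexp_neg_mul_sq_norm Real.pi_pos, div_self Real.pi_ne_zero,
      Real.one_rpow]
  have hgint : Integrable fun y : E => Real.exp (-Real.pi * ‖y‖ ^ 2) :=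
    .of_integral_ne_zero (by rw [hgi]; exact one_ne_zero)
  calc ∫⁻ x : E, ENNReal.ofReal (∏ i, f i ⟪u i, x⟫ ^ c i)
      = ∫⁻ x in A, ENNReal.ofReal (∏ i, f i ⟪u i, x⟫ ^ c i) := by
        rw [← lintegral_indicator hAm]
        refine lintegral_congr_ae ?_
        filter_upwards [hoff] with x hx
        by_cases h : x ∈ A
        · rw [Set.indicator_of_mem h]
        · rw [Set.indicator_of_notMem h, hx h]
    _ ≤ ∫⁻ x in A, ENNReal.ofReal |(Θ' x).det| *
          ENNReal.ofReal (Q * Real.exp (-Real.pi * ‖Θ x‖ ^ 2)) := setLIntegral_mono' hAm hpt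
    _ = ∫⁻ y in Θ '' A, ENNReal.ofReal (Q * Real.exp (-Real.pi * ‖y‖ ^ 2)) :=
        (lintegral_image_eq_lintegral_abs_det_fderiv_mul volume hAm hderiv hinj
          fun y => ENNReal.ofReal (Q * Real.exp (-Real.pi * ‖y‖ ^ 2))).symm
    _ ≤ ∫⁻ y : E, ENNReal.ofReal (Q * Real.exp (-Real.pi * ‖y‖ ^ 2)) := setLIntegral_le_lintegral _ _
    _ = ENNReal.ofReal Q := by
        rw [← ofReal_integral_eq_lintegral_ofReal (hgint.const_mul Q)
          (.of_forall fun y => mul_nonneg hQ0 (Real.exp_pos _).le), integral_const_mul, hgi, mul_one]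

theorem ball_brascamp_lieb (n m : ℕ) (hmn : n ≤ m)
    (u : Fin m → EuclideanSpace ℝ (Fin n)) (hu : ∀ i, ‖u i‖ = 1)
    (c : Fin m → ℝ) (hc : ∀ i, 0 < c i)
    (hdecomp : ∀ x : EuclideanSpace ℝ (Fin n), ∑ i, (c i * ⟪u i, x⟫) • u i = x)
    (f : Fin m → ℝ → ℝ) (hf : ∀ i, MeasureTheory.Integrable (f i))
    (h0 : ∀ i t, 0 ≤ f i t) :
    ∫ x : EuclideanSpace ℝ (Fin n), ∏ i, f i ⟪u i, x⟫ ^ c i ≤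
      ∏ i, (∫ t : ℝ, f i t) ^ c i := by
  have hQ : 0 ≤ ∏ i, (∫ t : ℝ, f i t) ^ c i :=
    Finset.prod_nonneg fun i _ => Real.rpow_nonneg (integral_nonneg (h0 i)) _
  by_cases h : Integrable fun x : EuclideanSpace ℝ (Fin n) => ∏ i, f i ⟪u i, x⟫ ^ c i
  · rw [← ENNReal.ofReal_le_ofReal_iff hQ, ofReal_integral_eq_lintegral_ofReal h
      (.of_forall fun x => Finset.prod_nonneg fun i _ => Real.rpow_nonneg (h0 i _) _)]
    exact lintegral_prod_rpow_inner_le hu hc hdecomp hf h0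
  · rwa [integral_undef h]
end

section
/- Let $1 \le k \le n/2$ and let $f(x) = \prod_{i=1}^n f_i(x_i)$ with each $f_i$ a probability density on $\mathbb{R}$ bounded by $1$. Then $\sup_{E \in G_{n,k}} \|\pi_E(f)\|_{L^\infty(E)} \le \sup_{E \in G_{n,k}} \|\pi_E(\mathbf{1}_{Q_n})\|_{L^\infty(E)}$, where $Q_n = [-1/2,1/2]^n$. -/
open MeasureTheory
open scoped ENNReal

section Pointwise

open scoped Pointwise

theorem volume_add_volume_le_of_isCompact {K L : Set ℝ} (hK : IsCompact K) (hL : IsCompact L)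
    (hK0 : K.Nonempty) (hL0 : L.Nonempty) : volume K + volume L ≤ volume (K + L) := by
  obtain ⟨a, haK, ha⟩ := hK.exists_isGreatest hK0
  obtain ⟨b, hbL, hb⟩ := hL.exists_isLeast hL0
  have hd : AEDisjoint volume (b +ᵥ K) (a +ᵥ L) := by
    refine measure_mono_null (t := {a + b}) ?_ (by simp)
    rintro _ ⟨⟨x, hx, rfl⟩, ⟨y, hy, h⟩⟩
    have h1 := ha hx
    have h2 := hb hy
    simp only [vadd_eq_add] at h ⊢
    rw [Set.mem_singleton_iff]
    linarith
  calc volume K + volume L = volume (b +ᵥ K) + volume (a +ᵥ L) := by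
        rw [measure_vadd, measure_vadd]
    _ = volume ((b +ᵥ K) ∪ (a +ᵥ L)) :=
        (measure_union₀ (hL.vadd a).measurableSet.nullMeasurableSet hd).symm
    _ ≤ volume (K + L) := by
        refine measure_mono (Set.union_subset ?_ ?_)
        · rintro _ ⟨x, hx, rfl⟩
          exact ⟨x, hx, b, hbL, by simp [add_comm]⟩
        · rintro _ ⟨y, hy, rfl⟩
          exact ⟨a, haK, y, hy, by simp⟩

/-- The Brunn-Minkowski inequality on the line. -/
theorem volume_add_volume_le {A B : Set ℝ} (hA : MeasurableSet A) (hB : MeasurableSet B)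
    (hA0 : A.Nonempty) (hB0 : B.Nonempty) : volume A + volume B ≤ volume (A + B) := by
  obtain ⟨a, ha⟩ := hA0
  obtain ⟨b, hb⟩ := hB0
  have key : ∀ K ⊆ A, IsCompact K → ∀ L ⊆ B, IsCompact L →
      volume K + volume L ≤ volume (A + B) := by
    intro K hKA hK L hLB hL
    calc volume K + volume L ≤ volume (insert a K) + volume (insert b L) := by
          gcongr <;> exact Set.subset_insert _ _
      _ ≤ volume (insert a K + insert b L) :=
          volume_add_volume_le_of_isCompact (hK.insert a) (hL.insert b)
            (Set.insert_nonempty _ _) (Set.insert_nonempty _ _)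
      _ ≤ volume (A + B) := measure_mono
          (Set.add_subset_add (Set.insert_subset ha hKA) (Set.insert_subset hb hLB))
  refine le_of_forall_lt fun c hc => ?_
  by_contra! hle
  have hfin : volume (A + B) ≠ ∞ := ne_top_of_le_ne_top hc.ne_top hle
  have h1 : ∀ L ⊆ B, IsCompact L → volume A ≤ volume (A + B) - volume L := by
    intro L hLB hL
    rw [hA.measure_eq_iSup_isCompact]
    refine iSup_le fun K => iSup_le fun hKA => iSup_le fun hK => ?_
    exact ENNReal.le_sub_of_add_le_right hL.measure_lt_top.ne (key K hKA hK L hLB hL)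
  have hAfin : volume A ≠ ∞ :=
    ne_top_of_le_ne_top hfin ((h1 ∅ (Set.empty_subset _) isCompact_empty).trans (by simp))
  have h2 : volume B ≤ volume (A + B) - volume A := by
    rw [hB.measure_eq_iSup_isCompact]
    refine iSup_le fun L => iSup_le fun hLB => iSup_le fun hL => ?_
    have hLle : volume L ≤ volume (A + B) := by
      simpa using key ∅ (Set.empty_subset _) isCompact_empty L hLB hL
    have := h1 L hLB hL
    refine ENNReal.le_sub_of_add_le_left hAfin ?_
    calc volume A + volume L ≤ (volume (A + B) - volume L) + volume L := by gcongr
      _ = _ := tsub_add_cancel_of_le hLle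
  have hAle : volume A ≤ volume (A + B) := by
    simpa using h1 ∅ (Set.empty_subset _) isCompact_empty
  have h3 : volume A + volume B ≤ volume (A + B) := by
    calc volume A + volume B ≤ volume A + (volume (A + B) - volume A) := by gcongr
      _ = _ := add_tsub_cancel_of_le hAle
  exact absurd (hc.trans_le h3) (not_lt.mpr hle)

theorem lintegral_eq_lintegral_Ioo_meas_lt {X : Type*} [MeasurableSpace X] (μ : Measure X)
    {f : X → ℝ≥0∞} (hf : Measurable f) (hf1 : ∀ x, f x ≤ 1) :
    ∫⁻ x, f x ∂μ = ∫⁻ t in Set.Ioo (0 : ℝ) 1, μ {x | ENNReal.ofReal t < f x} := by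
  have hfin : ∀ x, f x ≠ ∞ := fun x => ne_top_of_le_ne_top ENNReal.one_ne_top (hf1 x)
  have h := lintegral_eq_lintegral_meas_lt μ (f := fun x => (f x).toReal)
    (Filter.Eventually.of_forall fun x => ENNReal.toReal_nonneg) hf.ennreal_toReal.aemeasurable
  simp only [ENNReal.ofReal_toReal (hfin _)] at h
  rw [h, ← lintegral_indicator measurableSet_Ioi, ← lintegral_indicator measurableSet_Ioo]
  congr 1 with t
  by_cases h0 : 0 < t
  · by_cases h1 : t < 1
    · simp [Set.indicator, h0, h1, ENNReal.ofReal_lt_iff_lt_toReal h0.le (hfin _)]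
    · have : {x | t < (f x).toReal} = ∅ := by
        ext x
        have : (f x).toReal ≤ 1 := ENNReal.toReal_le_of_le_ofReal zero_le_one (by simpa using hf1 x)
        simp only [Set.mem_ofPred_eq, Set.mem_empty_iff_false, iff_false]
        linarith
      simp [Set.indicator, h0, h1, this]
  · simp [Set.indicator, h0]

theorem add_lintegral_le_lintegral_of_min_le {p q : ℝ} (hp : 0 < p) (hq : 0 < q)
    {f g h : ℝ → ℝ≥0∞} (hf : Measurable f) (hg : Measurable g) (hh : Measurable h)
    (hfs : (⨆ x, f x) = 1) (hgs : (⨆ x, g x) = 1)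
    (hfgh : ∀ x y, min (f x) (g y) ≤ h (p * x + q * y)) :
    ENNReal.ofReal p * (∫⁻ x, f x) + ENNReal.ofReal q * ∫⁻ x, g x ≤ ∫⁻ x, h x := by
  have hf1 : ∀ x, f x ≤ 1 := fun x => hfs ▸ le_iSup f x
  have hg1 : ∀ x, g x ≤ 1 := fun x => hgs ▸ le_iSup g x
  calc ENNReal.ofReal p * (∫⁻ x, f x) + ENNReal.ofReal q * ∫⁻ x, g x
      = ENNReal.ofReal p * (∫⁻ t in Set.Ioo (0 : ℝ) 1, volume {x | ENNReal.ofReal t < f x}) +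
        ENNReal.ofReal q * ∫⁻ t in Set.Ioo (0 : ℝ) 1, volume {x | ENNReal.ofReal t < g x} := by
        rw [lintegral_eq_lintegral_Ioo_meas_lt _ hf hf1, lintegral_eq_lintegral_Ioo_meas_lt _ hg hg1]
    _ = ∫⁻ t in Set.Ioo (0 : ℝ) 1, (ENNReal.ofReal p * volume {x | ENNReal.ofReal t < f x} +
        ENNReal.ofReal q * volume {x | ENNReal.ofReal t < g x}) := by
        have hanti : ∀ u : ℝ → ℝ≥0∞, Measurable fun t : ℝ => volume {x | ENNReal.ofReal t < u x} :=
          fun u => Antitone.measurable fun s t hst => measure_mono fun x hx =>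
            (ENNReal.ofReal_le_ofReal hst).trans_lt hx
        rw [lintegral_add_left ((hanti f).const_mul _), lintegral_const_mul _ (hanti f),
          lintegral_const_mul _ (hanti g)]
    _ ≤ ∫⁻ t in Set.Ioo (0 : ℝ) 1, volume {x | ENNReal.ofReal t < min (h x) 1} := by
        refine setLIntegral_mono' measurableSet_Ioo fun t ht => ?_
        have ht1 : ENNReal.ofReal t < 1 := by
          simpa using (ENNReal.ofReal_lt_ofReal_iff zero_lt_one).mpr ht.2
        obtain ⟨a, ha⟩ : ∃ x, ENNReal.ofReal t < f x := lt_iSup_iff.mp (hfs ▸ ht1)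
        obtain ⟨b, hb⟩ : ∃ x, ENNReal.ofReal t < g x := lt_iSup_iff.mp (hgs ▸ ht1)
        have hA : MeasurableSet {x | ENNReal.ofReal t < f x} := measurableSet_lt measurable_const hf
        have hB : MeasurableSet {x | ENNReal.ofReal t < g x} := measurableSet_lt measurable_const hg
        have := volume_add_volume_le (hA.const_smul_of_ne_zero hp.ne')
          (hB.const_smul_of_ne_zero hq.ne') ⟨_, a, ha, rfl⟩ ⟨_, b, hb, rfl⟩
        rw [Measure.addHaar_smul, Measure.addHaar_smul] at this
        simp only [Module.finrank_self, pow_one, abs_of_pos hp, abs_of_pos hq] at this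
        refine this.trans (measure_mono ?_)
        rintro _ ⟨_, ⟨x, hx, rfl⟩, _, ⟨y, hy, rfl⟩, rfl⟩
        exact lt_min ((lt_min hx hy).trans_le (hfgh x y)) ht1
    _ = ∫⁻ x, min (h x) 1 :=
        (lintegral_eq_lintegral_Ioo_meas_lt _ (hh.min measurable_const) fun x => min_le_right _ _).symm
    _ ≤ ∫⁻ x, h x := lintegral_mono fun x => min_le_left _ _

theorem ENNReal.rpow_mul_rpow_le_add {p q : ℝ} (hp : 0 < p) (hq : 0 < q) (hpq : p + q = 1)
    (a b : ℝ≥0∞) : a ^ p * b ^ q ≤ ENNReal.ofReal p * a + ENNReal.ofReal q * b := by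
  have hpq' : (p⁻¹).HolderConjugate q⁻¹ := by
    rw [Real.holderConjugate_iff]
    refine ⟨(one_lt_inv₀ hp).mpr (by linarith), by simpa using hpq⟩
  have := ENNReal.young_inequality (a ^ p) (b ^ q) hpq'
  rw [← ENNReal.rpow_mul, ← ENNReal.rpow_mul, mul_inv_cancel₀ hp.ne', mul_inv_cancel₀ hq.ne',
    ENNReal.rpow_one, ENNReal.rpow_one, ENNReal.ofReal_inv_of_pos hp, ENNReal.ofReal_inv_of_pos hq,
    div_eq_mul_inv, div_eq_mul_inv, inv_inv, inv_inv] at this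
  simpa [mul_comm] using this

theorem ENNReal.min_le_rpow_mul_rpow {p q : ℝ} (hp : 0 < p) (hq : 0 < q) (hpq : p + q = 1)
    (a b : ℝ≥0∞) : min a b ≤ a ^ p * b ^ q := by
  calc min a b = (min a b) ^ p * (min a b) ^ q := by
        rw [← ENNReal.rpow_add_of_nonneg _ _ hp.le hq.le, hpq, ENNReal.rpow_one]
    _ ≤ a ^ p * b ^ q := by
        gcongr
        · exact min_le_left _ _
        · exact min_le_right _ _

/-- The Prékopa-Leindler inequality holds for the measure `μ`. -/
def PrekopaLeindler {V : Type*} [AddCommGroup V] [Module ℝ V] [MeasurableSpace V]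
    (μ : Measure V) : Prop :=
  ∀ ⦃p q : ℝ⦄, 0 < p → 0 < q → p + q = 1 → ∀ ⦃f g h : V → ℝ≥0∞⦄,
    Measurable f → Measurable g → Measurable h →
    (∀ x y, f x ^ p * g y ^ q ≤ h (p • x + q • y)) →
    (∫⁻ x, f x ∂μ) ^ p * (∫⁻ x, g x ∂μ) ^ q ≤ ∫⁻ x, h x ∂μ

theorem prekopaLeindler_real_of_iSup_ne_top {p q : ℝ} (hp : 0 < p) (hq : 0 < q) (hpq : p + q = 1)
    {f g h : ℝ → ℝ≥0∞} (hf : Measurable f) (hg : Measurable g) (hh : Measurable h)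
    (hfs : (⨆ x, f x) ≠ ∞) (hgs : (⨆ x, g x) ≠ ∞)
    (hfgh : ∀ x y, f x ^ p * g y ^ q ≤ h (p * x + q * y)) :
    (∫⁻ x, f x) ^ p * (∫⁻ x, g x) ^ q ≤ ∫⁻ x, h x := by
  rcases eq_or_ne (⨆ x, f x) 0 with hf0 | hf0
  · have : f = 0 := by simpa [funext_iff] using hf0
    simp [this, hp]
  rcases eq_or_ne (⨆ x, g x) 0 with hg0 | hg0
  · have : g = 0 := by simpa [funext_iff] using hg0
    simp [this, hq]
  set α := ⨆ x, f x with hα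
  set β := ⨆ x, g x with hβ
  have hc0 : α ^ p * β ^ q ≠ 0 := by simp [hf0, hg0, hfs, hgs]
  have hct : α ^ p * β ^ q ≠ ∞ :=
    ENNReal.mul_ne_top (ENNReal.rpow_ne_top_of_nonneg hp.le hfs)
      (ENNReal.rpow_ne_top_of_nonneg hq.le hgs)
  have key := add_lintegral_le_lintegral_of_min_le hp hq (f := fun x => α⁻¹ * f x)
    (g := fun x => β⁻¹ * g x) (h := fun x => (α ^ p * β ^ q)⁻¹ * h x)
    (hf.const_mul _) (hg.const_mul _) (hh.const_mul _)
    (by rw [← ENNReal.mul_iSup, ← hα, ENNReal.inv_mul_cancel hf0 hfs])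
    (by rw [← ENNReal.mul_iSup, ← hβ, ENNReal.inv_mul_cancel hg0 hgs])
    (by
      intro x y
      refine (ENNReal.min_le_rpow_mul_rpow hp hq hpq _ _).trans ?_
      rw [ENNReal.mul_rpow_of_nonneg _ _ hp.le, ENNReal.mul_rpow_of_nonneg _ _ hq.le,
        mul_mul_mul_comm, ENNReal.inv_rpow, ENNReal.inv_rpow,
        ENNReal.mul_inv (by simp [hf0, hfs]) (by simp [hg0, hgs])]
      gcongr
      exact hfgh x y)
  have key2 := (ENNReal.rpow_mul_rpow_le_add hp hq hpq _ _).trans key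
  rw [lintegral_const_mul _ hf, lintegral_const_mul _ hg, lintegral_const_mul _ hh,
    ENNReal.mul_rpow_of_nonneg _ _ hp.le, ENNReal.mul_rpow_of_nonneg _ _ hq.le,
    mul_mul_mul_comm, ENNReal.inv_rpow, ENNReal.inv_rpow,
    ← ENNReal.mul_inv (by simp [hf0, hfs]) (by simp [hg0, hgs])] at key2
  exact (ENNReal.mul_le_mul_iff_right (ENNReal.inv_ne_zero.mpr hct)
    (ENNReal.inv_ne_top.mpr hc0)).mp key2

theorem prekopaLeindler_real : PrekopaLeindler (volume : Measure ℝ) := by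
  intro p q hp hq hpq f g h hf hg hh hfgh
  rcases eq_or_ne (∫⁻ x, f x) 0 with hf0 | hf0
  · simp [hf0, hp]
  rcases eq_or_ne (∫⁻ x, g x) 0 with hg0 | hg0
  · simp [hg0, hq]
  have hlim : ∀ u : ℝ → ℝ≥0∞, Measurable u →
      Filter.Tendsto (fun N : ℕ => ∫⁻ x, min (u x) N) Filter.atTop (nhds (∫⁻ x, u x)) := by
    intro u hu
    refine lintegral_tendsto_of_tendsto_of_monotone
      (fun N => (hu.min measurable_const).aemeasurable) ?_ ?_
    · refine Filter.Eventually.of_forall fun x a b hab => ?_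
      exact min_le_min_left _ (by exact_mod_cast hab)
    · refine Filter.Eventually.of_forall fun x => ?_
      simpa using tendsto_const_nhds.min ENNReal.tendsto_nat_nhds_top
  have ht := ENNReal.Tendsto.mul (((ENNReal.continuous_rpow_const (y := p)).tendsto _).comp (hlim f hf))
    (by simp [hf0, hp.le]) (((ENNReal.continuous_rpow_const (y := q)).tendsto _).comp (hlim g hg))
    (by simp [hg0, hq.le])
  refine le_of_tendsto' ht fun N => ?_
  have hb : ∀ u : ℝ → ℝ≥0∞, (⨆ x, min (u x) (N : ℝ≥0∞)) ≠ ∞ := fun u =>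
    ne_top_of_le_ne_top (ENNReal.natCast_ne_top N) (iSup_le fun x => min_le_right _ _)
  refine prekopaLeindler_real_of_iSup_ne_top hp hq hpq (hf.min measurable_const)
    (hg.min measurable_const) hh (hb f) (hb g) fun x y => le_trans ?_ (hfgh x y)
  gcongr <;> exact min_le_left _ _

theorem PrekopaLeindler.prod {V W : Type*} [AddCommGroup V] [Module ℝ V] [MeasurableSpace V]
    [AddCommGroup W] [Module ℝ W] [MeasurableSpace W] {μ : Measure V} {ν : Measure W} [SFinite ν]
    (hμ : PrekopaLeindler μ) (hν : PrekopaLeindler ν) : PrekopaLeindler (μ.prod ν) := by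
  intro p q hp hq hpq f g h hf hg hh hfgh
  rw [lintegral_prod _ hf.aemeasurable, lintegral_prod _ hg.aemeasurable,
    lintegral_prod _ hh.aemeasurable]
  refine hμ hp hq hpq hf.lintegral_prod_right' hg.lintegral_prod_right' hh.lintegral_prod_right'
    fun x y => ?_
  exact hν hp hq hpq (hf.comp measurable_prodMk_left) (hg.comp measurable_prodMk_left)
    (hh.comp measurable_prodMk_left) fun z w => hfgh (x, z) (y, w)

theorem PrekopaLeindler.of_measurePreserving {V W : Type*} [AddCommGroup V] [Module ℝ V]
    [MeasurableSpace V] [AddCommGroup W] [Module ℝ W] [MeasurableSpace W] {μ : Measure V}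
    {ν : Measure W} (hν : PrekopaLeindler ν) (e : W →ₗ[ℝ] V) (he : MeasurePreserving e ν μ) :
    PrekopaLeindler μ := by
  intro p q hp hq hpq f g h hf hg hh hfgh
  rw [← he.lintegral_comp hf, ← he.lintegral_comp hg, ← he.lintegral_comp hh]
  refine hν hp hq hpq (hf.comp he.measurable) (hg.comp he.measurable) (hh.comp he.measurable)
    fun x y => ?_
  simpa using hfgh (e x) (e y)

theorem prekopaLeindler_pi (m : ℕ) : PrekopaLeindler (volume : Measure (Fin m → ℝ)) := by
  induction m with
  | zero =>
    intro p q hp hq hpq f g h hf hg hh hfgh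
    rw [volume_pi, Measure.pi_of_empty, lintegral_dirac, lintegral_dirac, lintegral_dirac]
    convert hfgh _ _
  | succ m ih =>
    refine (prekopaLeindler_real.prod ih).of_measurePreserving
      (Fin.consLinearEquiv ℝ fun _ : Fin (m + 1) => ℝ).toLinearMap ?_
    have h := (volume_preserving_piFinSuccAbove (fun _ : Fin (m + 1) => ℝ) 0).symm
    have he : ⇑(Fin.consLinearEquiv ℝ fun _ : Fin (m + 1) => ℝ).toLinearMap =
        ⇑(MeasurableEquiv.piFinSuccAbove (fun _ : Fin (m + 1) => ℝ) 0).symm := by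
      funext x
      simp [MeasurableEquiv.piFinSuccAbove, Fin.consEquiv]
      rfl
    rw [he]
    exact h

theorem PrekopaLeindler.measure_slab_le {V ι : Type*} [AddCommGroup V] [Module ℝ V]
    [MeasurableSpace V] [MeasurableNeg V] {μ : Measure V} [μ.IsNegInvariant]
    (hμ : PrekopaLeindler μ) [Countable ι] (a : ι → V →ₗ[ℝ] ℝ) (ha : ∀ i, Measurable (a i))
    (c r : ι → ℝ) {t : ℝ} (ht0 : 0 ≤ t) (ht1 : t ≤ 1) :
    μ {x | ∀ i, |a i x - c i| < r i} ≤ μ {x | ∀ i, |a i x - t * c i| < r i} := by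
  rcases ht1.eq_or_lt with rfl | ht1
  · simp
  have hmeas : ∀ d : ι → ℝ, MeasurableSet {x | ∀ i, |a i x - d i| < r i} := fun d =>
    measurableSet_setOfPred.mpr <| .forall fun i => measurableSet_setOfPred.mp <|
      measurableSet_lt (by simpa using ((ha i).sub_const (d i)).norm) measurable_const
  set A := {x | ∀ i, |a i x - c i| < r i} with hA
  set B := {x | ∀ i, |a i x - t * c i| < r i} with hB
  have hp : 0 < (1 + t) / 2 := by linarith
  have hq : 0 < (1 - t) / 2 := by linarith
  have hpq : (1 + t) / 2 + (1 - t) / 2 = 1 := by ring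
  have key := hμ hp hq hpq (f := A.indicator 1) (g := (-A).indicator 1) (h := B.indicator 1)
    (measurable_one.indicator (hmeas c)) (measurable_one.indicator (hmeas c).neg)
    (measurable_one.indicator (hmeas _)) (by
      intro x y
      by_cases hx : x ∈ A
      · by_cases hy : y ∈ -A
        · have : ((1 + t) / 2) • x + ((1 - t) / 2) • y ∈ B := by
            intro i
            have h1 := abs_lt.mp (hx i)
            have h2 := abs_lt.mp (hy i)
            simp only [map_neg] at h2
            simp only [map_add, map_smul, smul_eq_mul]
            rw [abs_lt]
            constructor <;> nlinarith
          simp [hx, hy, this]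
        · simp [hy, hq]
      · simp [hx, hp])
  rw [lintegral_indicator_one (hmeas c), lintegral_indicator_one (hmeas c).neg,
    lintegral_indicator_one (hmeas _), Measure.measure_neg,
    ← ENNReal.rpow_add_of_nonneg _ _ hp.le hq.le, hpq, ENNReal.rpow_one] at key
  exact key

/-- The open intervals `(c j - r j, c j + r j)`, for `j ∈ S`, are nonempty and pairwise disjoint,
and their union has length one. -/
structure IsUnitBlocks (S : Finset ℕ) (c r : ℕ → ℝ) : Prop where
  pos : ∀ j ∈ S, 0 < r j
  sep : ∀ j ∈ S, ∀ k ∈ S, j ≠ k → r j + r k ≤ |c j - c k|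
  sum : ∑ j ∈ S, r j = 1 / 2

/-- The indicator function of a union of disjoint intervals. -/
noncomputable def blocks (S : Finset ℕ) (c r : ℕ → ℝ) (y : ℝ) : ℝ≥0∞ :=
  ∑ j ∈ S, if |y - c j| < r j then 1 else 0

theorem IsUnitBlocks.exists_merge_of_lt {S : Finset ℕ} {c r : ℕ → ℝ} (h : IsUnitBlocks S c r)
    {p q : ℕ} (hp : p ∈ S) (hq : q ∈ S) (hpq : c q - c p = r p + r q) :
    ∃ (S' : Finset ℕ) (c' r' : ℕ → ℝ), S'.card < S.card ∧ IsUnitBlocks S' c' r' ∧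
      ∀ y, blocks S c r y ≤ blocks S' c' r' y := by
  have hrp := h.pos p hp
  have hrq := h.pos q hq
  have hne : p ≠ q := by
    rintro rfl
    linarith
  have hpm : p ∈ S.erase q := Finset.mem_erase.mpr ⟨hne, hp⟩
  have hsep : ∀ j ∈ S, j ≠ p → j ≠ q → r j + (r p + r q) ≤ |c j - (c p + r q)| := by
    intro j hj hjp hjq
    have hrj := h.pos j hj
    have h1 := h.sep j hj p hp hjp
    have h2 := h.sep j hj q hq hjq
    rcases le_abs.mp h1 with h1 | h1
    · rcases le_abs.mp h2 with h2 | h2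
      · exact le_abs.mpr (Or.inl (by linarith))
      · linarith
    · exact le_abs.mpr (Or.inr (by linarith))
  refine ⟨S.erase q, Function.update c p (c p + r q), Function.update r p (r p + r q),
    Finset.card_erase_lt_of_mem hq, ⟨?_, ?_, ?_⟩, ?_⟩
  · intro j hj
    rcases eq_or_ne j p with rfl | hjp
    · simp [add_pos hrp hrq]
    · simpa [hjp] using h.pos j (Finset.mem_of_mem_erase hj)
  · intro j hj k hk hjk
    obtain ⟨hjq, hjS⟩ := Finset.mem_erase.mp hj
    obtain ⟨hkq, hkS⟩ := Finset.mem_erase.mp hk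
    rcases eq_or_ne j p with rfl | hjp
    · have := hsep k hkS hjk.symm hkq
      rw [abs_sub_comm] at this
      simp only [Function.update_self, Function.update_of_ne hjk.symm]
      linarith
    · rcases eq_or_ne k p with rfl | hkp
      · simpa [hjp] using hsep j hjS hjp hjq
      · simpa [hjp, hkp] using h.sep j hjS k hkS hjk
  · rw [← h.sum, ← Finset.add_sum_erase _ _ hpm, ← Finset.add_sum_erase S _ hq,
      ← Finset.add_sum_erase (S.erase q) _ hpm, Function.update_self,
      Finset.sum_congr rfl fun j hj => Function.update_of_ne (Finset.ne_of_mem_erase hj) _ _]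
    ring
  · intro y
    unfold blocks
    rw [← Finset.add_sum_erase S _ hq, ← Finset.add_sum_erase (S.erase q) _ hpm,
      ← Finset.add_sum_erase (S.erase q) _ hpm, ← add_assoc]
    gcongr ?_ + ?_
    · simp only [Function.update_self]
      by_cases h1 : |y - c q| < r q
      · have h1' := abs_lt.mp h1
        have h2 : ¬ |y - c p| < r p := fun h2 => by
          have := abs_lt.mp h2
          linarith
        have h3 : |y - (c p + r q)| < r p + r q := abs_lt.mpr ⟨by linarith, by linarith⟩
        simp [h1, h2, h3]
      · by_cases h2 : |y - c p| < r p
        · have h2' := abs_lt.mp h2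
          have h3 : |y - (c p + r q)| < r p + r q := abs_lt.mpr ⟨by linarith, by linarith⟩
          simp [h1, h2, h3]
        · simp [h1, h2]
    · refine (Finset.sum_congr rfl fun j hj => ?_).le
      rw [Function.update_of_ne (Finset.ne_of_mem_erase hj),
        Function.update_of_ne (Finset.ne_of_mem_erase hj)]

theorem IsUnitBlocks.exists_merge {S : Finset ℕ} {c r : ℕ → ℝ} (h : IsUnitBlocks S c r)
    {p q : ℕ} (hp : p ∈ S) (hq : q ∈ S) (hpq : |c p - c q| = r p + r q) :
    ∃ (S' : Finset ℕ) (c' r' : ℕ → ℝ), S'.card < S.card ∧ IsUnitBlocks S' c' r' ∧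
      ∀ y, blocks S c r y ≤ blocks S' c' r' y := by
  rcases abs_choice (c p - c q) with h1 | h1
  · exact h.exists_merge_of_lt hq hp (by linarith)
  · exact h.exists_merge_of_lt hp hq (by linarith)

theorem lintegral_prod_blocks {V ι : Type*} [MeasurableSpace V] {μ : Measure V} [Fintype ι]
    [DecidableEq ι] (a : ι → V → ℝ) (ha : ∀ i, Measurable (a i)) (S : ι → Finset ℕ)
    (c r : ι → ℕ → ℝ) :
    ∫⁻ x, ∏ i, blocks (S i) (c i) (r i) (a i x) ∂μ =
      ∑ u ∈ Fintype.piFinset S, μ {x | ∀ i, |a i x - c i (u i)| < r i (u i)} := by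
  have hmeas : ∀ d s : ι → ℝ, MeasurableSet {x | ∀ i, |a i x - d i| < s i} := fun d s =>
    measurableSet_setOfPred.mpr <| .forall fun i => measurableSet_setOfPred.mp <|
      measurableSet_lt (by simpa using ((ha i).sub_const (d i)).norm) measurable_const
  have h : ∀ x, ∏ i, blocks (S i) (c i) (r i) (a i x) = ∑ u ∈ Fintype.piFinset S,
      {x | ∀ i, |a i x - c i (u i)| < r i (u i)}.indicator 1 x := by
    intro x
    unfold blocks
    rw [Finset.prod_univ_sum]
    refine Finset.sum_congr rfl fun u _ => ?_
    rw [Fintype.prod_ite_zero]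
    simp [Set.indicator]
  simp_rw [h]
  rw [lintegral_finsetSum _ fun u _ => measurable_one.indicator (hmeas _ _)]
  exact Finset.sum_congr rfl fun u _ => lintegral_indicator_one (hmeas _ _)

/-- The Brascamp-Lieb-Luttinger inequality for finite unions of intervals of total length one:
slide all the intervals towards the origin until two of them touch, merge these, and repeat. -/
theorem PrekopaLeindler.lintegral_prod_blocks_le {V ι : Type*} [AddCommGroup V] [Module ℝ V]
    [MeasurableSpace V] [MeasurableNeg V] {μ : Measure V} [μ.IsNegInvariant]
    (hμ : PrekopaLeindler μ) [Fintype ι] (a : ι → V →ₗ[ℝ] ℝ) (ha : ∀ i, Measurable (a i))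
    (S : ι → Finset ℕ) (c r : ι → ℕ → ℝ) (h : ∀ i, IsUnitBlocks (S i) (c i) (r i)) :
    ∫⁻ x, ∏ i, blocks (S i) (c i) (r i) (a i x) ∂μ ≤ μ {x | ∀ i, |a i x| < 1 / 2} := by
  classical
  induction hN : ∑ i, (S i).card using Nat.strong_induction_on generalizing S c r with
  | _ N ih =>
  by_cases hS : ∀ i, (S i).card ≤ 1
  · have h1 : ∀ i, ∃ j, S i = {j} := fun i => by
      rw [← Finset.card_eq_one]
      refine le_antisymm (hS i) (Finset.card_pos.mpr ?_)
      by_contra h0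
      have := (h i).sum
      simp [Finset.not_nonempty_iff_eq_empty.mp h0] at this
    choose j hj using h1
    have hr : ∀ i, r i (j i) = 1 / 2 := fun i => by simpa [hj] using (h i).sum
    rw [lintegral_prod_blocks _ ha]
    have hpi : Fintype.piFinset S = {j} := by
      rw [show S = fun i => {j i} from funext hj, Fintype.piFinset_singleton]
    rw [hpi, Finset.sum_singleton]
    simpa [hr] using hμ.measure_slab_le a ha (fun i => c i (j i)) (fun i => r i (j i)) le_rfl
      zero_le_one
  · push Not at hS
    obtain ⟨i₀, hi₀⟩ := hS
    obtain ⟨j₀, hj₀, k₀, hk₀, hjk₀⟩ := Finset.one_lt_card.mp hi₀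
    let T : Finset (Σ _ : ι, ℕ × ℕ) := Finset.univ.sigma fun i => (S i).offDiag
    have hT : T.Nonempty := ⟨⟨i₀, j₀, k₀⟩, by simp [T, *]⟩
    obtain ⟨⟨i, p, q⟩, hmem, hmax⟩ := T.exists_max_image
      (fun u => (r u.1 u.2.1 + r u.1 u.2.2) / |c u.1 u.2.1 - c u.1 u.2.2|) hT
    obtain ⟨hp, hq, hpq⟩ : p ∈ S i ∧ q ∈ S i ∧ p ≠ q := by simpa [T] using hmem
    have hdist : ∀ i, ∀ j ∈ S i, ∀ k ∈ S i, j ≠ k → 0 < |c i j - c i k| := fun i j hj k hk hjk =>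
      (add_pos ((h i).pos j hj) ((h i).pos k hk)).trans_le ((h i).sep j hj k hk hjk)
    set t := (r i p + r i q) / |c i p - c i q| with ht
    have ht0 : 0 < t := div_pos (add_pos ((h i).pos p hp) ((h i).pos q hq)) (hdist i p hp q hq hpq)
    have ht1 : t ≤ 1 := div_le_one_of_le₀ ((h i).sep p hp q hq hpq) (abs_nonneg _)
    have habs : ∀ i j k, |t * c i j - t * c i k| = t * |c i j - c i k| := fun i j k => by
      rw [← mul_sub, abs_mul, abs_of_pos ht0]
    have hslide : ∀ i, IsUnitBlocks (S i) (fun j => t * c i j) (r i) := fun i =>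
      ⟨(h i).pos, fun j hj k hk hjk => by
        rw [habs, ← div_le_iff₀ (hdist i j hj k hk hjk)]
        exact hmax ⟨i, j, k⟩ (by simp [T, *]), (h i).sum⟩
    obtain ⟨S', c', r', hcard, hblock, hle⟩ := (hslide i).exists_merge hp hq
      (by rw [habs, ht, div_mul_cancel₀ _ (hdist i p hp q hq hpq).ne'])
    calc ∫⁻ x, ∏ i, blocks (S i) (c i) (r i) (a i x) ∂μ
        ≤ ∫⁻ x, ∏ i, blocks (S i) (fun j => t * c i j) (r i) (a i x) ∂μ := by
          rw [lintegral_prod_blocks _ ha, lintegral_prod_blocks _ ha]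
          exact Finset.sum_le_sum fun u _ =>
            hμ.measure_slab_le a ha (fun i => c i (u i)) (fun i => r i (u i)) ht0.le ht1
      _ ≤ ∫⁻ x, ∏ k, blocks (Function.update S i S' k)
            (Function.update (fun i j => t * c i j) i c' k) (Function.update r i r' k) (a k x)
            ∂μ := by
          refine lintegral_mono fun x => Finset.prod_le_prod' fun k _ => ?_
          rcases eq_or_ne k i with rfl | hk
          · simpa using hle (a k x)
          · simp [hk]
      _ ≤ μ {x | ∀ i, |a i x| < 1 / 2} := by
          refine ih _ ?_ _ _ _ (fun k => ?_) rfl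
          · rw [← hN]
            refine Finset.sum_lt_sum (fun k _ => ?_) ⟨i, Finset.mem_univ i, by simpa using hcard⟩
            rcases eq_or_ne k i with rfl | hk
            · simpa using hcard.le
            · simp [hk]
          · rcases eq_or_ne k i with rfl | hk
            · simpa using hblock
            · simpa [hk] using hslide k

end Pointwise

/-- A probability measure on the line whose density is at most one is the image of the uniform
measure on the unit interval under an expanding map. -/
theorem exists_expanding_map_eq {ν : Measure ℝ} [IsProbabilityMeasure ν] (hν : ν ≤ volume) :
    ∃ T : ℝ → ℝ, Measurable T ∧
      (∀ u ∈ Set.Ioo (0 : ℝ) 1, ∀ v ∈ Set.Ioo (0 : ℝ) 1, u ≤ v → v - u ≤ T v - T u) ∧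
      (volume.restrict (Set.Ioo (0 : ℝ) 1)).map T = ν := by
  set F := ProbabilityTheory.cdf ν with hF
  have hlip : ∀ x y, x ≤ y → F y - F x ≤ y - x := by
    intro x y hxy
    rw [← ENNReal.ofReal_le_ofReal_iff (by linarith), hF,
      ← StieltjesFunction.measure_Ioc, ProbabilityTheory.measure_cdf, ← Real.volume_Ioc]
    exact hν _
  have hcont : Continuous F := by
    refine (LipschitzWith.of_le_add_mul 1 fun x y => ?_).continuous
    rcases le_total x y with h | h
    · have := F.mono h
      have := dist_nonneg (x := x) (y := y)
      simp
      linarith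
    · have := hlip y x h
      rw [Real.dist_eq, abs_of_nonneg (by linarith)]
      simp
      linarith
  have hex : ∀ u : Set.Ioo (0 : ℝ) 1, ∃ y, F y = u := fun u =>
    mem_range_of_exists_le_of_exists_ge hcont
      ((ProbabilityTheory.tendsto_cdf_atBot ν).eventually_le_const u.2.1).exists
      ((ProbabilityTheory.tendsto_cdf_atTop ν).eventually_const_le u.2.2).exists
  choose T' hT' using hex
  have hexp : ∀ u v : Set.Ioo (0 : ℝ) 1, u ≤ v → (v : ℝ) - u ≤ T' v - T' u := by
    intro u v huv
    rcases le_total (T' u) (T' v) with h | h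
    · simpa [hT'] using hlip _ _ h
    · have := F.mono h
      rw [hT', hT'] at this
      rw [Subtype.ext (le_antisymm huv this)]
      simp
  have hmono : Monotone T' := fun u v huv => by
    have := hexp u v huv
    have : (u : ℝ) ≤ v := huv
    linarith
  obtain ⟨T, hT, hTT'⟩ := (MeasurableEmbedding.subtype_coe
    (measurableSet_Ioo (a := (0 : ℝ)) (b := 1))).exists_measurable_extend hmono.measurable
    fun _ => ⟨0⟩
  have hTv : ∀ u (hu : u ∈ Set.Ioo (0 : ℝ) 1), T u = T' ⟨u, hu⟩ := fun u hu =>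
    congrFun hTT' ⟨u, hu⟩
  refine ⟨T, hT, fun u hu v hv huv => ?_, ?_⟩
  · rw [hTv u hu, hTv v hv]
    exact hexp ⟨u, hu⟩ ⟨v, hv⟩ huv
  · symm
    refine Measure.ext_of_Iic _ _ fun a => ?_
    rw [Measure.map_apply hT measurableSet_Iic,
      Measure.restrict_apply (hT measurableSet_Iic), ← ProbabilityTheory.ofReal_cdf]
    refine le_antisymm ?_ ?_
    · calc ENNReal.ofReal (F a) = volume (Set.Ioo 0 (F a)) := by simp
        _ ≤ _ := measure_mono fun u hu => by
          have hu1 : u ∈ Set.Ioo (0 : ℝ) 1 :=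
            ⟨hu.1, hu.2.trans_le (ProbabilityTheory.cdf_le_one ν a)⟩
          refine ⟨?_, hu1⟩
          by_contra h
          rw [Set.mem_preimage, Set.mem_Iic, not_le, hTv u hu1] at h
          have := F.mono h.le
          rw [hT'] at this
          exact absurd hu.2 (not_lt.mpr this)
    · calc _ ≤ volume (Set.Ioc 0 (F a)) := measure_mono fun u hu => by
            refine ⟨hu.2.1, ?_⟩
            have := F.mono (Set.mem_Iic.mp hu.1)
            rwa [hTv u hu.2, hT'] at this
        _ = _ := by simp [hF]

theorem setLIntegral_Ioo_le_sum (φ : ℝ → ℝ≥0∞) {N : ℕ} (hN : 0 < N) :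
    ∫⁻ u in Set.Ioo (0 : ℝ) 1, φ u ≤
      ∑ j ∈ Finset.range N, ENNReal.ofReal (1 / N) *
        ∫⁻ θ in Set.Ioo (0 : ℝ) 1, φ ((j + θ) / N) := by
  have hN' : (0 : ℝ) < N := by exact_mod_cast hN
  have himage : ∀ j : ℕ, ∫⁻ u in (fun θ : ℝ => (j + θ) / N) '' Set.Ico 0 1, φ u =
      ENNReal.ofReal (1 / N) * ∫⁻ θ in Set.Ioo (0 : ℝ) 1, φ ((j + θ) / N) := by
    intro j
    rw [lintegral_image_eq_lintegral_abs_deriv_mul (f := fun θ : ℝ => (j + θ) / N)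
      (f' := fun _ => 1 / (N : ℝ)) measurableSet_Ico
      (fun x _ => (((hasDerivAt_id x).const_add (j : ℝ)).div_const (N : ℝ)).hasDerivWithinAt)
      (fun x _ y _ hxy => by
        have := (div_left_inj' hN'.ne').mp hxy
        linarith),
      abs_of_pos (by positivity), lintegral_const_mul' _ _ ENNReal.ofReal_ne_top,
      Measure.restrict_congr_set Ioo_ae_eq_Ico]
  have hcover : Set.Ioo (0 : ℝ) 1 ⊆
      ⋃ j : Fin N, (fun θ : ℝ => ((j : ℕ) + θ) / N) '' Set.Ico 0 1 := by
    intro u hu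
    have h0 : 0 ≤ u * N := by nlinarith [hu.1]
    have hlt : ⌊u * N⌋₊ < N := (Nat.floor_lt h0).mpr (by nlinarith [hu.2])
    refine Set.mem_iUnion.mpr ⟨⟨_, hlt⟩, u * N - ⌊u * N⌋₊, ⟨?_, ?_⟩, ?_⟩
    · linarith [Nat.floor_le h0]
    · linarith [Nat.lt_floor_add_one (u * N)]
    · simp [hN'.ne']
  calc ∫⁻ u in Set.Ioo (0 : ℝ) 1, φ u
      ≤ ∫⁻ u in ⋃ j : Fin N, (fun θ : ℝ => ((j : ℕ) + θ) / N) '' Set.Ico 0 1, φ u :=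
        lintegral_mono_set hcover
    _ ≤ ∑ j : Fin N, ∫⁻ u in (fun θ : ℝ => ((j : ℕ) + θ) / N) '' Set.Ico 0 1, φ u := by
        exact (lintegral_iUnion_le _ _).trans_eq (tsum_fintype _)
    _ = _ := by
        simp_rw [himage]
        exact Fin.sum_univ_eq_sum_range (fun j => ENNReal.ofReal (1 / N) *
          ∫⁻ θ in Set.Ioo (0 : ℝ) 1, φ ((j + θ) / N)) N

theorem isUnitBlocks_of_expanding {T : ℝ → ℝ}
    (hT : ∀ u ∈ Set.Ioo (0 : ℝ) 1, ∀ v ∈ Set.Ioo (0 : ℝ) 1, u ≤ v → v - u ≤ T v - T u)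
    {N : ℕ} (hN : 0 < N) (b : ℝ) {θ : ℝ} (hθ : θ ∈ Set.Ioo (0 : ℝ) 1) :
    IsUnitBlocks (Finset.range N) (fun j => T ((j + θ) / N) - b) fun _ => 1 / (2 * N) := by
  have hN' : (0 : ℝ) < N := by exact_mod_cast hN
  have hmem : ∀ j ∈ Finset.range N, ((j : ℝ) + θ) / N ∈ Set.Ioo (0 : ℝ) 1 := by
    intro j hj
    have hj' : (j : ℝ) + 1 ≤ N := by exact_mod_cast Finset.mem_range.mp hj
    have := hθ.1
    refine ⟨by positivity, ?_⟩
    rw [div_lt_one hN']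
    linarith [hθ.2]
  have hlt : ∀ j ∈ Finset.range N, ∀ k ∈ Finset.range N, j < k →
      1 / (2 * N) + 1 / (2 * N) ≤ T ((k + θ) / N) - T ((j + θ) / N) := by
    intro j hj k hk hjk
    have hjk' : (j : ℝ) + 1 ≤ k := by exact_mod_cast hjk
    refine le_trans ?_ (hT _ (hmem j hj) _ (hmem k hk) (by gcongr))
    rw [← sub_div, ← add_div, div_le_div_iff₀ (by positivity) hN']
    nlinarith
  refine ⟨fun _ _ => by positivity, fun j hj k hk hjk => ?_, ?_⟩
  · rw [sub_sub_sub_cancel_right]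
    rcases lt_or_gt_of_ne hjk with h | h
    · rw [abs_sub_comm]
      exact (hlt j hj k hk h).trans (le_abs_self _)
    · exact (hlt k hk j hj h).trans (le_abs_self _)
  · simp
    field_simp

theorem mul_measure_ball_le_lintegral_blocks {ν : Measure ℝ} {T : ℝ → ℝ} (hT : Measurable T)
    (hTν : (volume.restrict (Set.Ioo (0 : ℝ) 1)).map T = ν) {N : ℕ} (hN : 0 < N) (b z : ℝ) :
    N * ν (Metric.ball (z + b) (1 / (2 * N))) ≤
      ∫⁻ θ in Set.Ioo (0 : ℝ) 1,
        blocks (Finset.range N) (fun j => T ((j + θ) / N) - b) (fun _ => 1 / (2 * N)) z := by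
  have hN' : (0 : ℝ) < N := by exact_mod_cast hN
  have hmeas : ∀ j : ℕ, Measurable fun θ : ℝ =>
      (Metric.ball (z + b) (1 / (2 * N))).indicator (1 : ℝ → ℝ≥0∞) (T ((j + θ) / N)) := fun j =>
    (measurable_one.indicator Metric.isOpen_ball.measurableSet).comp (hT.comp (by fun_prop))
  calc N * ν (Metric.ball (z + b) (1 / (2 * N)))
      = N * ∫⁻ u in Set.Ioo (0 : ℝ) 1,
          (Metric.ball (z + b) (1 / (2 * N))).indicator 1 (T u) := by
        rw [← hTν, ← lintegral_indicator_one Metric.isOpen_ball.measurableSet,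
          lintegral_map (measurable_one.indicator Metric.isOpen_ball.measurableSet) hT]
    _ ≤ N * ∑ j ∈ Finset.range N, ENNReal.ofReal (1 / N) * ∫⁻ θ in Set.Ioo (0 : ℝ) 1,
          (Metric.ball (z + b) (1 / (2 * N))).indicator 1 (T ((j + θ) / N)) := by
        gcongr
        exact setLIntegral_Ioo_le_sum
          (fun u => (Metric.ball (z + b) (1 / (2 * N))).indicator 1 (T u)) hN
    _ = ∑ j ∈ Finset.range N, ∫⁻ θ in Set.Ioo (0 : ℝ) 1,
          (Metric.ball (z + b) (1 / (2 * N))).indicator 1 (T ((j + θ) / N)) := by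
        have : (N : ℝ≥0∞) * ENNReal.ofReal (1 / N) = 1 := by
          rw [← ENNReal.ofReal_natCast, ← ENNReal.ofReal_mul hN'.le, mul_one_div_cancel hN'.ne',
            ENNReal.ofReal_one]
        rw [← Finset.mul_sum, ← mul_assoc, this, one_mul]
    _ = ∫⁻ θ in Set.Ioo (0 : ℝ) 1, ∑ j ∈ Finset.range N,
          (Metric.ball (z + b) (1 / (2 * N))).indicator 1 (T ((j + θ) / N)) :=
        (lintegral_finsetSum _ fun j _ => hmeas j).symm
    _ = _ := by
        refine lintegral_congr fun θ => Finset.sum_congr rfl fun j _ => ?_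
        simp only [Set.indicator, Metric.mem_ball, Real.dist_eq, Pi.one_apply]
        rw [abs_sub_comm, sub_sub_eq_add_sub]

theorem lintegral_prod_setLIntegral_le {ι Θ X : Type*} [Fintype ι] [MeasurableSpace Θ]
    [MeasurableSpace X] {μ : Measure X} [SFinite μ] {ν : Measure Θ} [SFinite ν] {s : Set Θ}
    (hs : MeasurableSet s) (hs1 : ν s ≤ 1) {ψ : ι → X → Θ → ℝ≥0∞}
    (hψ : ∀ i, Measurable (Function.uncurry (ψ i))) {G : ℝ≥0∞}
    (h : ∀ θ : ι → Θ, (∀ i, θ i ∈ s) → ∫⁻ x, ∏ i, ψ i x (θ i) ∂μ ≤ G)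
    (hne : s.Nonempty) :
    ∫⁻ x, ∏ i, ∫⁻ θ in s, ψ i x θ ∂ν ∂μ ≤ G := by
  classical
  have hΨ : ∀ i, Measurable fun x => ∫⁻ θ in s, ψ i x θ ∂ν := fun i =>
    (hψ i).lintegral_prod_right'
  have key : ∀ t : Finset ι, ∀ θ : ι → Θ, (∀ i, θ i ∈ s) →
      ∫⁻ x, (∏ i ∈ t, ∫⁻ θ in s, ψ i x θ ∂ν) * ∏ i ∈ tᶜ, ψ i x (θ i) ∂μ ≤ G := by
    intro t
    induction t using Finset.induction_on with
    | empty => simpa using h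
    | insert k t hk ih =>
      intro θ hθ
      set R : X → ℝ≥0∞ := fun x =>
        (∏ i ∈ t, ∫⁻ θ in s, ψ i x θ ∂ν) * ∏ i ∈ (insert k t)ᶜ, ψ i x (θ i) with hR
      have hRm : Measurable R := (Finset.measurable_prod _ fun i _ => hΨ i).mul
        (Finset.measurable_prod _ fun i _ => (hψ i).comp measurable_prodMk_right)
      calc ∫⁻ x, (∏ i ∈ insert k t, ∫⁻ θ in s, ψ i x θ ∂ν) *
            ∏ i ∈ (insert k t)ᶜ, ψ i x (θ i) ∂μ
          = ∫⁻ x, ∫⁻ ω in s, ψ k x ω * R x ∂ν ∂μ := by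
            refine lintegral_congr fun x => ?_
            rw [lintegral_mul_const (R x) (f := ψ k x) ((hψ k).comp measurable_prodMk_left),
              Finset.prod_insert hk, mul_assoc]
        _ = ∫⁻ ω in s, ∫⁻ x, ψ k x ω * R x ∂μ ∂ν := by
            refine lintegral_lintegral_swap ?_
            exact ((hψ k).mul (hRm.comp measurable_fst)).aemeasurable
        _ ≤ ∫⁻ ω in s, G ∂ν := by
            refine setLIntegral_mono' hs fun ω hω => ?_
            refine le_trans (le_of_eq ?_) (ih (Function.update θ k ω) fun i => ?_)
            · refine lintegral_congr fun x => ?_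
              have hc : tᶜ = insert k (insert k t)ᶜ := by
                ext i
                by_cases hik : i = k <;> simp [hik, hk]
              have hu : ∏ i ∈ (insert k t)ᶜ, ψ i x (Function.update θ k ω i) =
                  ∏ i ∈ (insert k t)ᶜ, ψ i x (θ i) := by
                refine Finset.prod_congr rfl fun i hi => ?_
                rw [Function.update_of_ne]
                rintro rfl
                simp at hi
              rw [hc, Finset.prod_insert (by simp), Function.update_self, hR, hu]
              ring
            · rcases eq_or_ne i k with rfl | hik
              · simpa using hω
              · simpa [hik] using hθ i
        _ ≤ G := by
            rw [setLIntegral_const]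
            exact mul_le_of_le_one_right' hs1
  obtain ⟨ω, hω⟩ := hne
  simpa using key Finset.univ (fun _ => ω) fun _ => hω

theorem measurable_uncurry_blocks {X : Type*} [MeasurableSpace X] {a : X → ℝ} (ha : Measurable a)
    (S : Finset ℕ) {c : ℕ → ℝ → ℝ} (hc : ∀ j, Measurable (c j)) (r : ℕ → ℝ) :
    Measurable (Function.uncurry fun x θ => blocks S (fun j => c j θ) r (a x)) := by
  refine Finset.measurable_sum _ fun j _ => Measurable.ite ?_ measurable_const measurable_const
  exact measurableSet_lt (((ha.comp measurable_fst).sub ((hc j).comp measurable_snd)).abs)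
    measurable_const

theorem lintegral_prod_measure_ball_le {m : ℕ} {ι : Type*} [Fintype ι]
    (a : ι → (Fin m → ℝ) →ₗ[ℝ] ℝ) (b : ι → ℝ) (ν : ι → Measure ℝ)
    [∀ i, IsProbabilityMeasure (ν i)] (hν : ∀ i, ν i ≤ volume) {N : ℕ} (hN : 0 < N) :
    ∫⁻ x, ∏ i, N * ν i (Metric.ball (a i x + b i) (1 / (2 * N))) ≤
      volume {x | ∀ i, |a i x| < 1 / 2} := by
  have ha : ∀ i, Measurable (a i) := fun i => (a i).continuous_of_finiteDimensional.measurable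
  choose T hT hexp hTν using fun i => exists_expanding_map_eq (hν i)
  refine le_trans (lintegral_mono fun x => Finset.prod_le_prod' fun i _ =>
    mul_measure_ball_le_lintegral_blocks (hT i) (hTν i) hN (b i) (a i x)) ?_
  refine lintegral_prod_setLIntegral_le measurableSet_Ioo (by simp) (ψ := fun i x θ =>
    blocks (Finset.range N) (fun j => T i ((j + θ) / N) - b i) (fun _ => 1 / (2 * N)) (a i x))
    (fun i => ?_) (fun θ hθ => ?_) ⟨1 / 2, by norm_num⟩
  · exact measurable_uncurry_blocks (ha i) _
      (fun j => ((hT i).comp (by fun_prop)).sub_const _) _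
  · exact (prekopaLeindler_pi m).lintegral_prod_blocks_le a ha _ _ _
      fun i => isUnitBlocks_of_expanding (hexp i) hN (b i) (hθ i)

theorem ae_tendsto_mul_withDensity_ball {f : ℝ → ℝ≥0∞} (hf : Measurable f)
    (hfint : ∫⁻ t, f t ≠ ∞) :
    ∀ᵐ z, Filter.Tendsto (fun N : ℕ => ((N + 1 : ℕ) : ℝ≥0∞) *
      volume.withDensity f (Metric.ball z (1 / (2 * (N + 1 : ℕ))))) Filter.atTop (nhds (f z)) := by
  filter_upwards [(Besicovitch.vitaliFamily (volume : Measure ℝ)).ae_tendsto_lintegral_div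
    hf.aemeasurable hfint] with z hz
  have hr : Filter.Tendsto (fun N : ℕ => 1 / (2 * ((N + 1 : ℕ) : ℝ))) Filter.atTop
      (nhdsWithin 0 (Set.Ioi 0)) := by
    refine tendsto_nhdsWithin_iff.mpr ⟨?_, Filter.Eventually.of_forall fun N => ?_⟩
    · have := (tendsto_one_div_add_atTop_nhds_zero_nat (𝕜 := ℝ)).const_mul (1 / 2)
      rw [mul_zero] at this
      refine this.congr fun N => ?_
      push_cast
      field_simp
    · exact Set.mem_Ioi.mpr (by positivity)
  refine (hz.comp ((Besicovitch.tendsto_filterAt volume z).comp hr)).congr fun N => ?_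
  have hN : (0 : ℝ) < (N + 1 : ℕ) := by positivity
  simp only [Function.comp_apply]
  rw [withDensity_apply _ Metric.isOpen_ball.measurableSet, Real.volume_closedBall,
    Real.ball_eq_Ioo, Real.closedBall_eq_Icc, Measure.restrict_congr_set Ioo_ae_eq_Icc,
    div_eq_mul_inv, mul_comm, ← ENNReal.ofReal_inv_of_pos (by positivity),
    show (2 * (1 / (2 * ((N + 1 : ℕ) : ℝ))))⁻¹ = ((N + 1 : ℕ) : ℝ) by field_simp,
    ENNReal.ofReal_natCast]

theorem lintegral_prod_density_comp_le_of_ne_zero {m : ℕ} {ι : Type*} [Fintype ι]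
    (a : ι → (Fin m → ℝ) →ₗ[ℝ] ℝ) (ha0 : ∀ i, a i ≠ 0) (b : ι → ℝ) (f : ι → ℝ → ℝ≥0∞)
    (hf : ∀ i, Measurable (f i)) (hf1 : ∀ i t, f i t ≤ 1) (hint : ∀ i, ∫⁻ t, f i t = 1) :
    ∫⁻ x, ∏ i, f i (a i x + b i) ≤ volume {x | ∀ i, |a i x| < 1 / 2} := by
  have ha : ∀ i, Measurable (a i) := fun i => (a i).continuous_of_finiteDimensional.measurable
  have hν : ∀ i, volume.withDensity (f i) ≤ volume := fun i =>
    (withDensity_mono (Filter.Eventually.of_forall (hf1 i))).trans_eq withDensity_one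
  have hprob : ∀ i, IsProbabilityMeasure (volume.withDensity (f i)) := fun i =>
    ⟨by rw [withDensity_apply _ MeasurableSet.univ, Measure.restrict_univ, hint i]⟩
  have hae : ∀ᵐ x : Fin m → ℝ, ∀ i, Filter.Tendsto (fun N : ℕ => ((N + 1 : ℕ) : ℝ≥0∞) *
      volume.withDensity (f i) (Metric.ball (a i x + b i) (1 / (2 * (N + 1 : ℕ)))))
      Filter.atTop (nhds (f i (a i x + b i))) := by
    rw [ae_all_iff]
    intro i
    obtain ⟨c, _, hc⟩ := (a i).exists_map_addHaar_eq_smul_addHaar volume (volume : Measure ℝ)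
      (LinearMap.surjective (ha0 i))
    have hq : Measure.QuasiMeasurePreserving (a i) volume volume :=
      ⟨ha i, hc ▸ Measure.smul_absolutelyContinuous⟩
    exact ((measurePreserving_add_right volume (b i)).quasiMeasurePreserving.comp hq).ae
      (ae_tendsto_mul_withDensity_ball (hf i) (by simp [hint i]))
  calc ∫⁻ x, ∏ i, f i (a i x + b i)
      = ∫⁻ x, Filter.liminf (fun N : ℕ => ∏ i, ((N + 1 : ℕ) : ℝ≥0∞) *
          volume.withDensity (f i) (Metric.ball (a i x + b i) (1 / (2 * (N + 1 : ℕ)))))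
          Filter.atTop := by
        refine lintegral_congr_ae ?_
        filter_upwards [hae] with x hx
        exact (ENNReal.tendsto_finsetProd_of_ne_top _ (fun i _ => hx i) fun i _ =>
          ne_top_of_le_ne_top ENNReal.one_ne_top (hf1 i _)).liminf_eq.symm
    _ ≤ Filter.liminf (fun N : ℕ => ∫⁻ x, ∏ i, ((N + 1 : ℕ) : ℝ≥0∞) *
          volume.withDensity (f i) (Metric.ball (a i x + b i) (1 / (2 * (N + 1 : ℕ)))))
          Filter.atTop := by
        refine lintegral_liminf_le fun N => Finset.measurable_prod _ fun i _ => ?_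
        have : Measurable fun z : ℝ =>
            volume.withDensity (f i) (Metric.ball z (1 / (2 * (N + 1 : ℕ)))) :=
          measurable_measure_prodMk_left (s := {u : ℝ × ℝ | dist u.2 u.1 < 1 / (2 * (N + 1 : ℕ))})
            (measurableSet_lt (measurable_snd.dist measurable_fst) measurable_const)
        exact (this.comp ((ha i).add_const _)).const_mul _
    _ ≤ volume {x | ∀ i, |a i x| < 1 / 2} := by
        refine Filter.liminf_le_of_le (by isBoundedDefault) fun c hc => ?_
        obtain ⟨N, hN⟩ := hc.exists
        exact hN.trans (lintegral_prod_measure_ball_le a b _ hν N.succ_pos)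

/-- The Rogers-Brascamp-Lieb-Luttinger inequality for densities bounded by one. -/
theorem lintegral_prod_density_comp_le {m : ℕ} {ι : Type*} [Fintype ι]
    (a : ι → (Fin m → ℝ) →ₗ[ℝ] ℝ) (b : ι → ℝ) (f : ι → ℝ → ℝ≥0∞)
    (hf : ∀ i, Measurable (f i)) (hf1 : ∀ i t, f i t ≤ 1) (hint : ∀ i, ∫⁻ t, f i t = 1) :
    ∫⁻ x, ∏ i, f i (a i x + b i) ≤ volume {x | ∀ i, |a i x| < 1 / 2} := by
  classical
  calc ∫⁻ x, ∏ i, f i (a i x + b i)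
      ≤ ∫⁻ x, ∏ i : {i // a i ≠ 0}, f i (a i x + b i) := by
        refine lintegral_mono fun x => ?_
        rw [← Fintype.prod_subtype_mul_prod_subtype (fun i => a i ≠ 0)]
        exact mul_le_of_le_one_right' (Finset.prod_le_one' fun i _ => hf1 i _)
    _ ≤ volume {x | ∀ i : {i // a i ≠ 0}, |a i x| < 1 / 2} :=
        lintegral_prod_density_comp_le_of_ne_zero (fun i : {i // a i ≠ 0} => a i)
          (fun i => i.2) (fun i => b i) (fun i => f i) (fun i => hf i) (fun i => hf1 i)
          fun i => hint i
    _ ≤ volume {x | ∀ i, |a i x| < 1 / 2} := measure_mono fun x hx i => by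
        by_cases hi : a i = 0
        · simp [hi]
        · exact hx ⟨i, hi⟩

theorem exists_hausdorffMeasure_restrict_flat_eq {n m : ℕ}
    (F : Submodule ℝ (EuclideanSpace ℝ (Fin n))) (hF : Module.finrank ℝ F = m) :
    ∃ (c : NNReal) (L : (Fin m → ℝ) →ₗ[ℝ] EuclideanSpace ℝ (Fin n)), Function.Injective L ∧
      ∀ x, (μH[(m : ℝ)]).restrict ((x + ·) '' (F : Set (EuclideanSpace ℝ (Fin n)))) =
        c • Measure.map (fun z => x + L z) volume := by
  let e : EuclideanSpace ℝ (Fin m) ≃ₗᵢ[ℝ] F :=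
    ((stdOrthonormalBasis ℝ F).reindex (finCongr hF)).repr.symm
  let s : EuclideanSpace ℝ (Fin m) ≃L[ℝ] (Fin m → ℝ) := PiLp.continuousLinearEquiv 2 ℝ _
  have hs : Measure.map s.symm (volume : Measure (Fin m → ℝ)) = volume :=
    (PiLp.volume_preserving_toLp (Fin m)).map_eq
  obtain ⟨c, hc⟩ : ∃ c : NNReal, (μH[(m : ℝ)] : Measure (EuclideanSpace ℝ (Fin m))) =
      c • volume := ⟨_, Measure.isAddLeftInvariant_eq_smul _ _⟩
  refine ⟨c, F.subtype ∘ₗ e.toLinearEquiv.toLinearMap ∘ₗ s.symm.toLinearEquiv.toLinearMap,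
    F.injective_subtype.comp (e.injective.comp s.symm.injective), fun x => ?_⟩
  have hiso : Isometry fun z : EuclideanSpace ℝ (Fin m) => x + (e z : EuclideanSpace ℝ (Fin n)) :=
    (IsometryEquiv.addLeft x).isometry.comp (F.subtypeₗᵢ.isometry.comp e.isometry)
  have hrange : Set.range (fun z : EuclideanSpace ℝ (Fin m) =>
      x + (e z : EuclideanSpace ℝ (Fin n))) = (x + ·) '' (F : Set _) := by
    ext y
    constructor
    · rintro ⟨z, rfl⟩
      exact ⟨_, (e z).2, rfl⟩
    · rintro ⟨w, hw, rfl⟩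
      exact ⟨e.symm ⟨w, hw⟩, by simp⟩
  rw [← hrange, ← hiso.map_hausdorffMeasure (Or.inl m.cast_nonneg), hc, Measure.map_smul, ← hs,
    Measure.map_map hiso.continuous.measurable s.symm.continuous.measurable]
  rfl

theorem isCompact_setOf_forall_mem_Icc {ι : Type*} [Fintype ι] (a b : ℝ) :
    IsCompact {y : EuclideanSpace ℝ ι | ∀ i, y i ∈ Set.Icc a b} := by
  have h := (PiLp.continuousLinearEquiv 2 ℝ fun _ : ι => ℝ).toHomeomorph.isCompact_preimage.mpr
    (isCompact_univ_pi fun _ : ι => isCompact_Icc (a := a) (b := b))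
  convert h using 1
  ext y
  exact Set.mem_univ_pi.symm

theorem setIntegral_prod_flat_le {n m : ℕ} {f : Fin n → ℝ → ℝ} (hmeas : ∀ i, Measurable (f i))
    (h0 : ∀ i t, 0 ≤ f i t) (h1 : ∀ i t, f i t ≤ 1) (hint : ∀ i, ∫ t : ℝ, f i t = 1)
    (F : Submodule ℝ (EuclideanSpace ℝ (Fin n))) (hF : Module.finrank ℝ F = m)
    (x : EuclideanSpace ℝ (Fin n)) :
    ENNReal.ofReal (∫ y in ((x + ·) '' (F : Set (EuclideanSpace ℝ (Fin n)))),
        ∏ i, f i (y i) ∂μH[(m : ℝ)]) ≤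
      ENNReal.ofReal (∫ y in (((0 : EuclideanSpace ℝ (Fin n)) + ·) '' (F : Set _)),
        Set.indicator (Set.univ.pi fun _ : Fin n => Set.Icc (-(1 : ℝ) / 2) (1 / 2))
          (fun _ => (1 : ℝ)) y ∂μH[(m : ℝ)]) := by
  obtain ⟨c, L, hL, hflat⟩ := exists_hausdorffMeasure_restrict_flat_eq F hF
  have hLc : Continuous L := L.continuous_of_finiteDimensional
  rw [hflat, hflat]
  let Q : Set (EuclideanSpace ℝ (Fin n)) := {y | ∀ i, y i ∈ Set.Icc (-(1 : ℝ) / 2) (1 / 2)}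
  have hQ : IsCompact Q := isCompact_setOf_forall_mem_Icc _ _
  have hfin : volume (L ⁻¹' Q) ≠ ∞ := ((LinearMap.isClosedEmbedding_of_injective
    (LinearMap.ker_eq_bot.mpr hL)).isCompact_preimage hQ).measure_ne_top
  have hQm : (c • Measure.map (fun z => 0 + L z) volume) Q = c • volume (L ⁻¹' Q) := by
    simp only [zero_add]
    rw [Measure.smul_apply, Measure.map_apply hLc.measurable hQ.measurableSet]
  have hrhs : ENNReal.ofReal (∫ y, Set.indicator
      (Set.univ.pi fun _ : Fin n => Set.Icc (-(1 : ℝ) / 2) (1 / 2)) (fun _ => (1 : ℝ))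
        (y : EuclideanSpace ℝ (Fin n)) ∂(c • Measure.map (fun z => 0 + L z) volume)) =
      c • volume (L ⁻¹' Q) := by
    have : ∀ y : EuclideanSpace ℝ (Fin n), Set.indicator
        (Set.univ.pi fun _ : Fin n => Set.Icc (-(1 : ℝ) / 2) (1 / 2)) (fun _ => (1 : ℝ)) y =
        Q.indicator 1 y := fun y => by
      simp only [Set.indicator, Set.mem_univ_pi, Q, Set.mem_ofPred_eq, Pi.one_apply]
    simp only [this]
    rw [integral_indicator_one hQ.measurableSet, measureReal_def, hQm, ENNReal.ofReal_toReal]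
    exact ENNReal.mul_ne_top ENNReal.coe_ne_top hfin
  have hf' : ∀ i, Measurable fun t => ENNReal.ofReal (f i t) := fun i => (hmeas i).ennreal_ofReal
  have hint' : ∀ i, ∫⁻ t, ENNReal.ofReal (f i t) = 1 := fun i => by
    rw [← ofReal_integral_eq_lintegral_ofReal (by_contra fun h => by
      simpa [integral_undef h] using hint i) (Filter.Eventually.of_forall (h0 i)), hint i,
      ENNReal.ofReal_one]
  have hprod : Measurable fun y : EuclideanSpace ℝ (Fin n) => ∏ i, ENNReal.ofReal (f i (y i)) :=
    Finset.measurable_prod _ fun i _ => (hf' i).comp (by fun_prop)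
  rw [hrhs]
  calc _ ≤ ∫⁻ y, ∏ i, ENNReal.ofReal (f i (y i)) ∂(c • Measure.map (fun z => x + L z) volume) := by
        rw [integral_eq_lintegral_of_nonneg_ae
          (Filter.Eventually.of_forall fun y => Finset.prod_nonneg fun i _ => h0 i _)
          (Finset.measurable_prod _ fun i _ =>
            (hmeas i).comp (by fun_prop)).aestronglyMeasurable]
        refine ENNReal.ofReal_toReal_le.trans_eq (lintegral_congr fun y => ?_)
        exact ENNReal.ofReal_prod_of_nonneg fun i _ => h0 i _
    _ = c • ∫⁻ z, ∏ i, ENNReal.ofReal (f i (L z i + x i)) := by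
        rw [lintegral_smul_measure, lintegral_map hprod (hLc.measurable.const_add x)]
        simp only [PiLp.add_apply, add_comm]
    _ ≤ c • volume {z | ∀ i, |L z i| < 1 / 2} := by
        gcongr
        exact lintegral_prod_density_comp_le
          (fun i => (EuclideanSpace.proj (𝕜 := ℝ) i).toLinearMap ∘ₗ L)
          (fun i => x i) _ hf' (fun i t => ENNReal.ofReal_le_one.mpr (h1 i t)) hint'
    _ ≤ c • volume (L ⁻¹' Q) := by
        gcongr
        intro z hz i
        have := abs_lt.mp (hz i)
        exact ⟨by linarith, by linarith⟩

theorem worst_case_comparison_with_cube (n k : ℕ) (hk1 : 1 ≤ k) (h2k : 2 * k ≤ n)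
    (f : Fin n → ℝ → ℝ) (hmeas : ∀ i, Measurable (f i)) (h0 : ∀ i t, 0 ≤ f i t)
    (h1 : ∀ i t, f i t ≤ 1) (hint : ∀ i, ∫ t : ℝ, f i t = 1) :
    (⨆ E : {E : Submodule ℝ (EuclideanSpace ℝ (Fin n)) // Module.finrank ℝ E = k},
      ⨆ x ∈ (E.1 : Set (EuclideanSpace ℝ (Fin n))),
        ENNReal.ofReal (∫ y in ((x + ·) '' (E.1ᗮ : Set (EuclideanSpace ℝ (Fin n)))),
          ∏ i, f i (y i) ∂μH[((n - k : ℕ) : ℝ)])) ≤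
      ⨆ E : {E : Submodule ℝ (EuclideanSpace ℝ (Fin n)) // Module.finrank ℝ E = k},
        ⨆ x ∈ (E.1 : Set (EuclideanSpace ℝ (Fin n))),
          ENNReal.ofReal (∫ y in ((x + ·) '' (E.1ᗮ : Set (EuclideanSpace ℝ (Fin n)))),
            Set.indicator (Set.univ.pi fun _ : Fin n => Set.Icc (-(1 : ℝ) / 2) (1 / 2))
              (fun _ => (1 : ℝ)) y ∂μH[((n - k : ℕ) : ℝ)]) := by
  refine iSup_le fun E => iSup₂_le fun x _ => le_iSup_of_le E <| le_iSup₂_of_le 0 E.1.zero_mem ?_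
  refine setIntegral_prod_flat_le hmeas h0 h1 hint _ ?_ x
  have h := E.1.finrank_add_finrank_orthogonal
  rw [E.2, finrank_euclideanSpace_fin] at h
  omega
end
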